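/- arXiv:1805.11389 — 2 statements merged into one kernel-verified Lean document; each statement's English description precedes it below -/
import Mathlib

section
/- Assume (F0)-(F5). Let t ∈ [0,T] and suppose there exist u, v ∈ C(t) (i.e. ∇ₓF(t,u) = ∇ₓF(t,v) = 0) with F(t,u) − F(t,v) = c_t(u,v). Then there exist m ∈ ℕ, distinct points u⁰, u¹, …, u^m ∈ C(t) with u⁰ = u and u^m = v, and functions v¹, …, v^m : ℝ → X such that for every i = 1, …, m: A v̈ⁱ(s) + B v̇ⁱ(s) + ∇ₓF(t, vⁱ(s)) = 0 for all s ∈ ℝ; lim_{s→−∞} vⁱ(s) = u^{i−1} and lim_{s→+∞} vⁱ(s) = uⁱ; and lim_{s→±∞} v̇ⁱ(s) = 0. -/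
open Set Filter Topology MeasureTheory
open scoped RealInnerProductSpace

noncomputable def cost {X : Type*} [NormedAddCommGroup X] [InnerProductSpace ℝ X]
    (A B Binv : X →L[ℝ] X) (gradF : ℝ → X → X) (t : ℝ) (u₁ u₂ : X) : ℝ :=
  sInf { c : ℝ | ∃ (N : ℕ) (v v' v'' : ℝ → X),
    -- v is C¹ on [-N,N] with derivative v'
    (∀ s ∈ Set.Icc (-(N : ℝ)) (N : ℝ),
      HasDerivWithinAt v (v' s) (Set.Icc (-(N : ℝ)) (N : ℝ)) s) ∧
    ContinuousOn v' (Set.Icc (-(N : ℝ)) (N : ℝ)) ∧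
    -- v' is absolutely continuous with (second) derivative v'' in L²
    MeasureTheory.IntegrableOn v'' (Set.Icc (-(N : ℝ)) (N : ℝ)) ∧
    MeasureTheory.IntegrableOn (fun s => ‖v'' s‖ ^ 2) (Set.Icc (-(N : ℝ)) (N : ℝ)) ∧
    (∀ s ∈ Set.Icc (-(N : ℝ)) (N : ℝ), v' s = v' (-(N : ℝ)) + ∫ r in (-(N : ℝ))..s, v'' r) ∧
    -- boundary conditions
    v (-(N : ℝ)) = u₁ ∧ v (N : ℝ) = u₂ ∧ v' (-(N : ℝ)) = 0 ∧ v' (N : ℝ) = 0 ∧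
    -- value of the functional
    c = (1 / 2) * ∫ s in (-(N : ℝ))..(N : ℝ),
      (⟪gradF t (v s) + A (v'' s), Binv (gradF t (v s) + A (v'' s))⟫
        + ⟪v' s, B (v' s)⟫) }


section Abstract

set_option linter.unusedSectionVars false

variable {Z : Type*} [NormedAddCommGroup Z] [NormedSpace ℝ Z] [ProperSpace Z]

/-- `z` is an approximate trajectory of `f`, with error `ε`, staying in the ball of radius `M`. -/
structure Approx (f : Z → Z) (M C ε : ℝ) (z : ℝ → Z) : Prop where
  cont : Continuous z
  mem : ∀ s, z s ∈ Metric.closedBall (0 : Z) M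
  est : ∀ a b : ℝ, |b - a| ≤ 1 → ‖z b - z a - (b - a) • f (z a)‖ ≤ C * (b - a) ^ 2 + ε

lemma Approx.mono {f : Z → Z} {M C ε ε' : ℝ} {z : ℝ → Z} (h : Approx f M C ε z) (he : ε ≤ ε') :
    Approx f M C ε' z :=
  ⟨h.cont, h.mem, fun a b hab => (h.est a b hab).trans (by linarith)⟩

lemma Approx.shift {f : Z → Z} {M C ε : ℝ} {z : ℝ → Z} (h : Approx f M C ε z) (τ : ℝ) :
    Approx f M C ε (fun s => z (τ + s)) := by
  refine ⟨h.cont.comp (by fun_prop), fun s => h.mem _, fun a b hab => ?_⟩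
  have := h.est (τ + a) (τ + b) (by simpa using hab)
  simpa using this

lemma Approx.hasDerivAt {f : Z → Z} {M C : ℝ} {z : ℝ → Z} (h : Approx f M C 0 z) (s : ℝ) :
    HasDerivAt z (f (z s)) s := by
  rw [hasDerivAt_iff_isLittleO]
  have h1 : (fun x' => z x' - z s - (x' - s) • f (z s)) =O[𝓝 s] fun x' => (x' - s) ^ 2 := by
    refine Asymptotics.IsBigO.of_bound C ?_
    have : ∀ᶠ x in 𝓝 s, |x - s| ≤ 1 := by
      filter_upwards [Metric.closedBall_mem_nhds s one_pos] with x hx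
      simpa [Real.dist_eq] using hx
    filter_upwards [this] with x hx
    have := h.est s x hx
    simpa using this
  refine h1.trans_isLittleO ?_
  have h2 : (fun x' : ℝ => (x' - s)) =o[𝓝 s] fun _ => (1 : ℝ) := by
    rw [Asymptotics.isLittleO_one_iff]
    have : Tendsto (fun x' : ℝ => x' - s) (𝓝 s) (𝓝 (s - s)) := by
      apply Continuous.tendsto; fun_prop
    simpa using this
  have := (Asymptotics.isBigO_refl (fun x' : ℝ => x' - s) (𝓝 s)).mul_isLittleO h2
  simpa [sq] using this

/-- Limits along ultrafilters of approximate trajectories are trajectories. -/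
lemma approx_limit {ι : Type*} (U : Ultrafilter ι) {f : Z → Z} {M C : ℝ}
    (hf : ContinuousOn f (Metric.closedBall 0 M))
    {z : ι → ℝ → Z} {ε : ι → ℝ} (hε : Tendsto ε U (𝓝 0)) (hz : ∀ i, Approx f M C (ε i) (z i)) :
    ∃ w : ℝ → Z, (∀ s, Tendsto (fun i => z i s) U (𝓝 (w s))) ∧ Approx f M C 0 w := by
  have hlim : ∀ s, ∃ x ∈ Metric.closedBall (0 : Z) M, Tendsto (fun i => z i s) U (𝓝 x) := by
    intro s
    have hc : IsCompact (Metric.closedBall (0 : Z) M) := isCompact_closedBall _ _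
    obtain ⟨x, hx, hxl⟩ := hc.ultrafilter_le_nhds (U.map (fun i => z i s))
      (by simp only [Ultrafilter.coe_map, le_principal_iff, mem_map]
          exact Filter.univ_mem' fun i => (hz i).mem s)
    exact ⟨x, hx, hxl⟩
  choose w hwm hw using hlim
  have hest : ∀ a b : ℝ, |b - a| ≤ 1 → ‖w b - w a - (b - a) • f (w a)‖ ≤ C * (b - a) ^ 2 + 0 := by
    intro a b hab
    have h1 : Tendsto (fun i => f (z i a)) U (𝓝 (f (w a))) := by
      have := (hf (w a) (hwm a))
      refine this.tendsto.comp ?_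
      rw [tendsto_nhdsWithin_iff]
      exact ⟨hw a, Filter.univ_mem' fun i => (hz i).mem a⟩
    refine le_of_tendsto_of_tendsto
      (((hw b).sub (hw a)).sub (h1.const_smul (b - a))).norm (tendsto_const_nhds.add hε) ?_
    exact Filter.univ_mem' fun i => (hz i).est a b hab
  refine ⟨w, hw, ⟨?_, hwm, hest⟩⟩
  -- continuity
  rw [continuous_iff_continuousAt]
  intro s
  have key : Tendsto (fun b => w b - w s - (b - s) • f (w s)) (𝓝 s) (𝓝 0) := by
    refine squeeze_zero_norm' (a := fun b => C * (b - s) ^ 2 + 0) ?_ ?_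
    · filter_upwards [Metric.closedBall_mem_nhds s one_pos] with x hx
      exact hest s x (by simpa [Real.dist_eq] using hx)
    · have : Tendsto (fun b : ℝ => C * (b - s) ^ 2 + 0) (𝓝 s) (𝓝 (C * (s - s) ^ 2 + 0)) := by
        apply Continuous.tendsto; fun_prop
      simpa using this
  have k2 : Tendsto (fun b => w s + (b - s) • f (w s)) (𝓝 s) (𝓝 (w s + (s - s) • f (w s))) := by
    apply Continuous.tendsto; fun_prop
  have := key.add k2
  simp only [sub_self, zero_smul, add_zero, zero_add] at this
  refine this.congr fun b => ?_
  abel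

/-- A trajectory converges to an equilibrium along `l` (to be used with `atTop` and `atBot`). -/
lemma tendsto_equilibrium (l : Filter ℝ) [l.NeBot]
    (hl : ∀ P : ℝ → Prop, (∀ᶠ s in l, P s) → ∃ S ∈ l, IsPreconnected S ∧ ∀ s ∈ S, P s)
    (hls : ∀ a : ℝ, Tendsto (fun s => s + a) l l)
    {f : Z → Z} {E : Z → ℝ} {M C : ℝ}
    (hf : ContinuousOn f (Metric.closedBall 0 M)) (hE : Continuous E)
    (hstrict : ∀ w, Approx f M C 0 w → (∀ s, E (w s) = E (w 0)) → f (w 0) = 0)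
    (hiso : ∀ x, f x = 0 → ∃ r > (0 : ℝ), ∀ y, f y = 0 → y ∈ Metric.ball x r → y = x)
    {w : ℝ → Z} (hw : Approx f M C 0 w) {e : ℝ} (he : Tendsto (fun s => E (w s)) l (𝓝 e)) :
    ∃ b, f b = 0 ∧ b ∈ Metric.closedBall (0 : Z) M ∧ Tendsto w l (𝓝 b) ∧ E b = e := by
  -- every ultrafilter limit is an equilibrium
  have hU : ∀ U : Ultrafilter ℝ, (U : Filter ℝ) ≤ l →
      ∃ b, f b = 0 ∧ b ∈ Metric.closedBall (0 : Z) M ∧ Tendsto w U (𝓝 b) ∧ E b = e := by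
    intro U hUl
    obtain ⟨v, hv, hva⟩ := approx_limit U hf (z := fun τ s => w (τ + s)) (ε := fun _ => 0)
      tendsto_const_nhds (fun τ => hw.shift τ)
    have hEv : ∀ s, E (v s) = e := by
      intro s
      have h1 : Tendsto (fun τ => E (w (τ + s))) U (𝓝 (E (v s))) :=
        (hE.tendsto _).comp (hv s)
      have h2 : Tendsto (fun τ => E (w (τ + s))) U (𝓝 e) :=
        he.comp ((hls s).mono_left hUl)
      exact tendsto_nhds_unique h1 h2
    refine ⟨v 0, hstrict v hva (fun s => by rw [hEv, hEv]), hva.mem 0, ?_, hEv 0⟩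
    simpa using hv 0
  obtain ⟨b, hb0, hbM, hbt, hbe⟩ := hU (Ultrafilter.of l) (Ultrafilter.of_le l)
  refine ⟨b, hb0, hbM, ?_, hbe⟩
  obtain ⟨r, hr, hbr⟩ := hiso b hb0
  rw [Metric.tendsto_nhds]
  by_contra hcon
  push Not at hcon
  obtain ⟨η, hη, hfreq⟩ := hcon
  set ρ := min η (r / 2) with hρ
  have hρ0 : 0 < ρ := lt_min hη (by linarith)
  have hf1 : ∃ᶠ s in l, dist (w s) b = ρ := by
    intro hne
    obtain ⟨S, hS, hSc, hSP⟩ := hl _ hne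
    obtain ⟨s1, hs1S, hs1⟩ : ∃ s ∈ S, ρ < dist (w s) b ∨ ρ ≤ dist (w s) b := by
      by_contra hno
      push Not at hno
      apply hfreq
      filter_upwards [hS] with s hs
      have := (hno s hs).2
      have := min_le_left η (r/2)
      simp only [not_le]
      linarith
    have hs1' : ρ ≤ dist (w s1) b := hs1.elim le_of_lt id
    obtain ⟨s2, hs2S, hs2⟩ : ∃ s ∈ S, dist (w s) b < ρ := by
      have h1 : ∀ᶠ s in (Ultrafilter.of l : Filter ℝ), dist (w s) b < ρ :=
        (Metric.tendsto_nhds.1 hbt) ρ hρ0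
      have h2 : ∀ᶠ s in (Ultrafilter.of l : Filter ℝ), s ∈ S := Ultrafilter.of_le l hS
      obtain ⟨s, hs⟩ := (h1.and h2).exists
      exact ⟨s, hs.2, hs.1⟩
    have hcd : ContinuousOn (fun s => dist (w s) b) S :=
      (hw.cont.dist continuous_const).continuousOn
    obtain ⟨s, hs, hsρ⟩ := hSc.intermediate_value hs2S hs1S hcd ⟨hs2.le, hs1'⟩
    exact hSP s hs hsρ
  have hne : (l ⊓ 𝓟 {s | dist (w s) b = ρ}).NeBot := frequently_mem_iff_neBot.1 hf1
  obtain ⟨b', hb'0, -, hb't, -⟩ := hU (Ultrafilter.of (l ⊓ 𝓟 {s | dist (w s) b = ρ}))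
    ((Ultrafilter.of_le _).trans inf_le_left)
  have hd : dist b' b = ρ := by
    have h1 := hb't.dist (tendsto_const_nhds (x := b))
    refine tendsto_nhds_unique h1 (tendsto_const_nhds.congr' ?_)
    have h3 : ∀ᶠ s in (Ultrafilter.of (l ⊓ 𝓟 {s | dist (w s) b = ρ}) : Filter ℝ),
        s ∈ {s | dist (w s) b = ρ} :=
      (Ultrafilter.of_le _).trans inf_le_right (mem_principal_self _)
    filter_upwards [h3] with s hs
    exact hs.symm
  have : b' = b := hbr b' hb'0 (by
    rw [Metric.mem_ball, hd]
    have := min_le_right η (r/2)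
    linarith)
  rw [this, dist_self] at hd
  linarith

lemma exists_first_exit {φ : ℝ → ℝ} (hφ : Continuous φ) {s S δ : ℝ} (hs : φ s < δ)
    (hsS : s ≤ S) (hS : δ ≤ φ S) : ∃ τ, s ≤ τ ∧ φ τ = δ ∧ ∀ x ∈ Icc s τ, φ x ≤ δ := by
  set K := Icc s S ∩ {x | δ ≤ φ x} with hK
  have hKc : IsCompact K := isCompact_Icc.inter_right (isClosed_le continuous_const hφ)
  obtain ⟨τ, hτ, hmin⟩ := hKc.exists_isLeast ⟨S, ⟨hsS, le_rfl⟩, hS⟩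
  have hlt : ∀ x ∈ Icc s τ, x < τ → φ x < δ := by
    intro x hx hxτ
    by_contra hcon
    push Not at hcon
    have := hmin (show x ∈ K from ⟨⟨hx.1, hx.2.trans hτ.1.2⟩, hcon⟩)
    linarith
  have heq : φ τ = δ := by
    obtain ⟨x, hx, hxe⟩ := intermediate_value_Icc hτ.1.1 hφ.continuousOn ⟨hs.le, hτ.2⟩
    rcases hx.2.lt_or_eq with h | h
    · exact absurd hxe (hlt x hx h).ne
    · rw [← h]; exact hxe
  refine ⟨τ, hτ.1.1, heq, fun x hx => ?_⟩
  rcases hx.2.lt_or_eq with h | h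
  · exact (hlt x hx h).le
  · rw [h, heq]

/-- `c` is approached by approximate trajectories that end at `q`. -/
def Approached (f : Z → Z) (M C : ℝ) (q c : Z) : Prop :=
  ∀ ε > (0 : ℝ), ∃ z, Approx f M C ε z ∧ (∃ s, dist (z s) c < ε) ∧ ∃ S, ∀ s ≥ S, z s = q

/-- a heteroclinic connection -/
def Het (f : Z → Z) (E : Z → ℝ) (c b : Z) : Prop :=
  f c = 0 ∧ f b = 0 ∧ E b < E c ∧
    ∃ w : ℝ → Z, (∀ s, HasDerivAt w (f (w s)) s) ∧ Tendsto w atBot (𝓝 c) ∧ Tendsto w atTop (𝓝 b)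

lemma step {f : Z → Z} {E : Z → ℝ} {M C : ℝ} {L : NNReal}
    (hf : LipschitzOnWith L f (Metric.closedBall 0 M)) (hE : Continuous E)
    (hanti : ∀ w, Approx f M C 0 w → Antitone (fun s => E (w s)))
    (hstrict : ∀ w, Approx f M C 0 w → (∀ s, E (w s) = E (w 0)) → f (w 0) = 0)
    (hiso : ∀ x, f x = 0 → ∃ r > (0 : ℝ), ∀ y, f y = 0 → y ∈ Metric.ball x r → y = x)
    {q c : Z} (hc : f c = 0) (hcM : c ∈ Metric.closedBall (0 : Z) M)
    (hP : Approached f M C q c) (hcq : c ≠ q) :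
    ∃ b, b ∈ Metric.closedBall (0 : Z) M ∧ Approached f M C q b ∧ Het f E c b := by
  obtain ⟨r, hr, hcr⟩ := hiso c hc
  have hfc := hf.continuousOn
  have hdq : 0 < dist q c := dist_pos.2 hcq.symm
  set δ := min (r / 2) (dist q c) with hδ
  have hδ0 : 0 < δ := lt_min (by linarith) hdq
  have hδr : δ < r := lt_of_le_of_lt (min_le_left _ _) (by linarith)
  have hzero : ∀ y, f y = 0 → dist y c ≤ δ → y = c := fun y hy hyd =>
    hcr y hy (by rw [Metric.mem_ball]; linarith)
  set ε : ℕ → ℝ := fun n => δ * (1 / ((n : ℝ) + 1)) with hεdef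
  have hεpos : ∀ n, 0 < ε n := fun n => by simp only [hεdef]; positivity
  have hεle : ∀ n, ε n ≤ δ := fun n => by
    have : 1 / ((n : ℝ) + 1) ≤ 1 := by
      rw [div_le_one (by positivity)]; linarith [(Nat.cast_nonneg n : (0:ℝ) ≤ n)]
    calc ε n ≤ δ * 1 := mul_le_mul_of_nonneg_left this hδ0.le
      _ = δ := mul_one _
  have hεlim : Tendsto ε atTop (𝓝 0) := by
    have := (tendsto_one_div_add_atTop_nhds_zero_nat (𝕜 := ℝ)).const_mul δ
    rw [mul_zero] at this
    exact this
  have hPn := fun n => hP (ε n) (hεpos n)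
  choose z hz sex Sex using hPn
  choose s hs using sex
  choose S hS using Sex
  have hτ : ∀ n, ∃ τ, s n ≤ τ ∧ dist (z n τ) c = δ ∧ ∀ x ∈ Icc (s n) τ, dist (z n x) c ≤ δ := by
    intro n
    refine exists_first_exit (φ := fun x => dist (z n x) c) ((hz n).cont.dist continuous_const)
      ((hs n).trans_le (hεle n)) (le_max_left (s n) (S n)) ?_
    rw [hS n _ (le_max_right _ _)]
    exact min_le_right _ _
  choose τ hsτ hτδ hτle using hτ
  set U : Ultrafilter ℕ := hyperfilter ℕ with hUdef
  have hUle : (U : Filter ℕ) ≤ atTop := Nat.hyperfilter_le_atTop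
  have hεU : Tendsto ε U (𝓝 0) := hεlim.mono_left hUle
  obtain ⟨w, hw, hwa⟩ := approx_limit U hfc hεU (z := fun n x => z n (τ n + x))
    (fun n => (hz n).shift (τ n))
  have hw0 : dist (w 0) c = δ := by
    have h1 := (hw 0).dist (tendsto_const_nhds (x := c))
    simp only [add_zero, hτδ] at h1
    exact tendsto_nhds_unique h1 tendsto_const_nhds
  -- exit takes arbitrarily long
  have hlong : ∀ R : ℝ, 0 ≤ R → ∀ᶠ n in (U : Filter ℕ), R ≤ τ n - s n := by
    intro R hR
    by_contra hcon
    have hcon' : ∀ᶠ n in (U : Filter ℕ), ¬ (R ≤ τ n - s n) := Ultrafilter.eventually_not.2 hcon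
    obtain ⟨σ, hσ, hσl⟩ := (isCompact_Icc (a := (0:ℝ)) (b := R)).ultrafilter_le_nhds
      (U.map (fun n => τ n - s n)) (by
        simp only [Ultrafilter.coe_map, le_principal_iff, mem_map]
        filter_upwards [hcon'] with n hn
        exact ⟨by linarith [hsτ n], by linarith⟩)
    have hσl' : Tendsto (fun n => τ n - s n) U (𝓝 σ) := hσl
    have hwσ : w (-σ) = c := by
      have h0 : Tendsto (fun n => z n (s n)) U (𝓝 c) := by
        rw [tendsto_iff_dist_tendsto_zero]
        exact squeeze_zero (fun _ => dist_nonneg) (fun n => (hs n).le) hεU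
      have h1 := hw (-σ)
      have hh : Tendsto (fun n => s n - (τ n + -σ)) U (𝓝 0) := by
        have := (hσl'.sub_const σ).neg
        simp only [sub_self, neg_zero] at this
        refine this.congr fun n => by ring
      have hfl : Tendsto (fun n => f (z n (τ n + -σ))) U (𝓝 (f (w (-σ)))) := by
        refine (hfc _ (hwa.mem _)).tendsto.comp ?_
        rw [tendsto_nhdsWithin_iff]
        exact ⟨h1, Filter.univ_mem' fun n => (hz n).mem _⟩
      have h2 : Tendsto (fun n => z n (s n) - z n (τ n + -σ)
          - (s n - (τ n + -σ)) • f (z n (τ n + -σ))) U (𝓝 0) := by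
        refine squeeze_zero_norm' (a := fun n => C * (s n - (τ n + -σ)) ^ 2 + ε n) ?_ ?_
        · have : ∀ᶠ n in (U : Filter ℕ), |s n - (τ n + -σ)| < 1 := by
            have := (Metric.tendsto_nhds.1 hh) 1 one_pos
            simpa [Real.dist_eq] using this
          filter_upwards [this] with n hn
          exact (hz n).est _ _ hn.le
        · have := ((hh.pow 2).const_mul C).add hεU
          simpa using this
      have h3 := (h0.sub h1).sub (hh.smul hfl)
      have h4 := tendsto_nhds_unique h2 h3
      simp only [zero_smul, sub_zero] at h4
      exact (sub_eq_zero.1 h4.symm).symm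
    have huniq : EqOn w (fun _ => c) (Icc (-σ - 1) (1 : ℝ)) := by
      refine ODE_solution_unique_of_mem_Icc (v := fun _ => f) (K := L)
        (s := fun _ => Metric.closedBall 0 M) (t₀ := -σ) (fun _ _ => hf)
        ⟨by linarith, by linarith [hσ.1]⟩ hwa.cont.continuousOn (fun x _ => hwa.hasDerivAt x)
        (fun x _ => hwa.mem x) continuousOn_const (fun x _ => ?_) (fun _ _ => hcM) hwσ
      rw [hc]; exact hasDerivAt_const _ _
    have : w 0 = c := huniq ⟨by linarith [hσ.1], zero_le_one⟩
    rw [this, dist_self] at hw0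
    linarith
  have hwneg : ∀ x ≤ 0, dist (w x) c ≤ δ := by
    intro x hx
    refine le_of_tendsto ((hw x).dist (tendsto_const_nhds (x := c))) ?_
    filter_upwards [hlong (-x) (by linarith)] with n hn
    exact hτle n _ ⟨by linarith, by linarith⟩
  have hA := hanti w hwa
  have hEbdd : ∃ D, ∀ x ∈ Metric.closedBall (0 : Z) M, ‖E x‖ ≤ D :=
    (isCompact_closedBall _ _).exists_bound_of_continuousOn hE.continuousOn
  obtain ⟨D, hD⟩ := hEbdd
  have hlimTop : ∃ e, Tendsto (fun s => E (w s)) atTop (𝓝 e) :=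
    ⟨_, tendsto_atTop_ciInf hA ⟨-D, by
      rintro _ ⟨s, rfl⟩; exact (abs_le.1 (hD _ (hwa.mem s))).1⟩⟩
  have hlimBot : ∃ e, Tendsto (fun s => E (w s)) atBot (𝓝 e) :=
    ⟨_, tendsto_atBot_ciSup hA ⟨D, by
      rintro _ ⟨s, rfl⟩; exact (abs_le.1 (hD _ (hwa.mem s))).2⟩⟩
  obtain ⟨e1, he1⟩ := hlimTop
  obtain ⟨e2, he2⟩ := hlimBot
  obtain ⟨b, hb0, hbM, hbt, hbe⟩ := tendsto_equilibrium atTop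
    (fun P hP => by
      obtain ⟨a, ha⟩ := eventually_atTop.1 hP
      exact ⟨Ici a, Ici_mem_atTop a, isPreconnected_Ici, ha⟩)
    (fun a => tendsto_atTop_add_const_right _ a tendsto_id) hfc hE hstrict hiso hwa he1
  obtain ⟨a, ha0, haM, hat, hae⟩ := tendsto_equilibrium atBot
    (fun P hP => by
      obtain ⟨a, ha⟩ := eventually_atBot.1 hP
      exact ⟨Iic a, Iic_mem_atBot a, isPreconnected_Iic, ha⟩)
    (fun a => tendsto_atBot_add_const_right _ a tendsto_id) hfc hE hstrict hiso hwa he2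
  have hac : a = c := by
    refine hzero a ha0 (le_of_tendsto (hat.dist (tendsto_const_nhds (x := c))) ?_)
    filter_upwards [Iic_mem_atBot (0 : ℝ)] with x hx
    exact hwneg x hx
  subst hac
  have hge : ∀ s, E b ≤ E (w s) := fun s => by rw [hbe]; exact hA.le_of_tendsto he1 s
  have hle : ∀ s, E (w s) ≤ E a := fun s => by rw [hae]; exact hA.ge_of_tendsto he2 s
  refine ⟨b, hbM, ?_, ha0, hb0, ?_, w, hwa.hasDerivAt, hat, hbt⟩
  · intro η hη
    have h1 : ∀ᶠ x in atTop, dist (w x) b < η / 2 := Metric.tendsto_nhds.1 hbt _ (by linarith)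
    obtain ⟨x, hx⟩ := h1.exists
    have h2 : ∀ᶠ n in (U : Filter ℕ), dist (z n (τ n + x)) (w x) < η / 2 :=
      Metric.tendsto_nhds.1 (hw x) _ (by linarith)
    have h3 : ∀ᶠ n in (U : Filter ℕ), ε n < η := (tendsto_order.1 hεU).2 _ hη
    obtain ⟨n, hn2, hn3⟩ := (h2.and h3).exists
    refine ⟨z n, (hz n).mono hn3.le, ⟨τ n + x, ?_⟩, S n, hS n⟩
    linarith [dist_triangle (z n (τ n + x)) (w x) b]
  · by_contra hcon
    push Not at hcon
    have hconst : ∀ s, E (w s) = E a := fun s => le_antisymm (hle s) (hcon.trans (hge s))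
    have := hzero _ (hstrict w hwa fun s => by rw [hconst, hconst]) hw0.le
    rw [this, dist_self] at hw0
    linarith

lemma chain {f : Z → Z} {E : Z → ℝ} {M C : ℝ} {L : NNReal}
    (hf : LipschitzOnWith L f (Metric.closedBall 0 M)) (hE : Continuous E)
    (hanti : ∀ w, Approx f M C 0 w → Antitone (fun s => E (w s)))
    (hstrict : ∀ w, Approx f M C 0 w → (∀ s, E (w s) = E (w 0)) → f (w 0) = 0)
    (hiso : ∀ x, f x = 0 → ∃ r > (0 : ℝ), ∀ y, f y = 0 → y ∈ Metric.ball x r → y = x)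
    {q c : Z} (hc : f c = 0) (hcM : c ∈ Metric.closedBall (0 : Z) M)
    (hP : Approached f M C q c) : Relation.ReflTransGen (Het f E) c q := by
  have hfin : (Metric.closedBall (0 : Z) M ∩ f ⁻¹' {0}).Finite := by
    have hcl : IsClosed (Metric.closedBall (0 : Z) M ∩ f ⁻¹' {0}) :=
      hf.continuousOn.preimage_isClosed_of_isClosed Metric.isClosed_closedBall isClosed_singleton
    have hco : IsCompact (Metric.closedBall (0 : Z) M ∩ f ⁻¹' {0}) :=
      (isCompact_closedBall (0 : Z) M).of_isClosed_subset hcl inter_subset_left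
    by_contra hinf
    obtain ⟨x, hx, hacc⟩ := Set.Infinite.exists_accPt_of_subset_isCompact hinf hco subset_rfl
    obtain ⟨r, hr, hxr⟩ := hiso x hx.2
    rw [accPt_iff_nhds] at hacc
    obtain ⟨y, hy, hne⟩ := hacc _ (Metric.ball_mem_nhds x hr)
    exact hne (hxr y hy.2.2 hy.1)
  by_contra hcon
  obtain ⟨d, hd, hdmin⟩ := Set.exists_min_image
    {x | x ∈ Metric.closedBall (0 : Z) M ∩ f ⁻¹' {0} ∧ Approached f M C q x ∧
      ¬ Relation.ReflTransGen (Het f E) x q} E (hfin.subset fun x hx => hx.1)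
    ⟨c, ⟨hcM, hc⟩, hP, hcon⟩
  have hdq : d ≠ q := by
    rintro rfl; exact hd.2.2 Relation.ReflTransGen.refl
  obtain ⟨b, hbM, hbP, hbH⟩ := step hf hE hanti hstrict hiso hd.1.2 hd.1.1 hd.2.1 hdq
  have := hdmin b ⟨⟨hbM, hbH.2.1⟩, hbP, fun h => hd.2.2 (Relation.ReflTransGen.head hbH h)⟩
  linarith [hbH.2.2.1]

end Abstract

lemma chain_of_reflTransGen {α : Type*} {R : α → α → Prop} {a b : α}
    (h : Relation.ReflTransGen R a b) :
    ∃ (m : ℕ) (w : ℕ → α), w 0 = a ∧ w m = b ∧ ∀ i < m, R (w i) (w (i + 1)) := by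
  induction h using Relation.ReflTransGen.head_induction_on with
  | refl => exact ⟨0, fun _ => b, rfl, rfl, fun i hi => absurd hi (Nat.not_lt_zero i)⟩
  | @head a c hac _ ih =>
    obtain ⟨m, w, h0, hm, hR⟩ := ih
    refine ⟨m + 1, fun i => Nat.casesOn i a w, rfl, hm, fun i hi => ?_⟩
    cases i with
    | zero => simpa [h0] using hac
    | succ i => exact hR i (by omega)

section Analysis

lemma ac_const (c a b : ℝ) : AbsolutelyContinuousOnInterval (fun _ : ℝ => c) a b :=
  ((LipschitzWith.const c).lipschitzOnWith (s := uIcc a b)).absolutelyContinuousOnInterval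

lemma ac_sum {ι : Type*} (s : Finset ι) (φ : ι → ℝ → ℝ) (a b : ℝ)
    (h : ∀ i ∈ s, AbsolutelyContinuousOnInterval (φ i) a b) :
    AbsolutelyContinuousOnInterval (fun x => ∑ i ∈ s, φ i x) a b := by
  classical
  induction s using Finset.induction_on with
  | empty => simpa using ac_const 0 a b
  | insert i s hi ih =>
    simp only [Finset.sum_insert hi]
    exact (h i (Finset.mem_insert_self i s)).fun_add
      (ih fun j hj => h j (Finset.mem_insert_of_mem hj))

variable {X : Type*} [NormedAddCommGroup X] [InnerProductSpace ℝ X] [FiniteDimensional ℝ X]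

lemma kinetic (A : X →L[ℝ] X) (hAsymm : ∀ x y : X, ⟪A x, y⟫ = ⟪x, A y⟫)
    {a b : ℝ} (hab : a ≤ b) {y y' : ℝ → X} (hyint : IntervalIntegrable y' volume a b)
    (hy : ∀ s ∈ Icc a b, y s = y a + ∫ r in a..s, y' r) :
    ∫ s in a..b, 2 * ⟪A (y' s), y s⟫ = ⟪y b, A (y b)⟫ - ⟪y a, A (y a)⟫ := by
  set Y : ℝ → X := fun s => y a + ∫ r in a..s, y' r with hY
  have hYy : ∀ s ∈ Icc a b, y s = Y s := hy
  set e := stdOrthonormalBasis ℝ X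
  have hcoord : ∀ x : X, AbsolutelyContinuousOnInterval (fun s => ⟪x, Y s⟫) a b := by
    intro x
    have hi : IntervalIntegrable (fun s => ⟪x, y' s⟫) volume a b :=
      ⟨hyint.1.const_inner x, hyint.2.const_inner x⟩
    have h1 := (ac_const ⟪x, y a⟫ a b).fun_add
      (hi.absolutelyContinuousOnInterval_intervalIntegral (c := a) left_mem_uIcc)
    have hoi : ∀ s ∈ Icc a b, ⟪x, Y s⟫ = ⟪x, y a⟫ + ∫ r in a..s, ⟪x, y' r⟫ := by
      intro s hs
      have hyint' : IntervalIntegrable y' volume a s := hyint.mono_set (by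
        rw [uIcc_of_le hs.1, uIcc_of_le hab]; exact Icc_subset_Icc_right hs.2)
      have := (innerSL ℝ x).intervalIntegral_comp_comm hyint'
      simp only [innerSL_apply_apply] at this
      rw [this, hY]
      simp only [inner_add_right]
    rw [absolutelyContinuousOnInterval_iff] at h1 ⊢
    intro ε hε
    obtain ⟨δ, hδ, hh⟩ := h1 ε hε
    refine ⟨δ, hδ, fun E hE hlt => ?_⟩
    have := hh E hE hlt
    convert this using 2 with i hi
    have h2 := hE.1 i hi
    rw [uIcc_of_le hab] at h2
    rw [hoi _ h2.1, hoi _ h2.2]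
  have hac : AbsolutelyContinuousOnInterval (fun s => ⟪Y s, A (Y s)⟫) a b := by
    have : (fun s => ⟪Y s, A (Y s)⟫) = fun s => ∑ i, ⟪e i, Y s⟫ * ⟪A (e i), Y s⟫ := by
      funext s
      rw [← e.sum_inner_mul_inner (Y s) (A (Y s))]
      refine Finset.sum_congr rfl fun i _ => ?_
      rw [real_inner_comm, hAsymm (e i) (Y s)]
    rw [this]
    exact ac_sum _ _ _ _ fun i _ => (hcoord _).fun_mul (hcoord _)
  rw [hYy b ⟨hab, le_rfl⟩, hYy a ⟨le_rfl, hab⟩, ← hac.integral_deriv_eq_sub]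
  apply intervalIntegral.integral_congr_ae
  filter_upwards [hyint.ae_hasDerivAt_integral] with s hs hsm
  have hsm' := uIoc_subset_uIcc hsm
  have hd : HasDerivAt Y (y' s) s := (hs hsm' a left_mem_uIcc).const_add (y a)
  have hd2 : HasDerivAt (fun s => A (Y s)) (A (y' s)) s := A.hasFDerivAt.comp_hasDerivAt s hd
  have h3 := (hd.inner ℝ hd2).deriv
  rw [h3, hYy s (by rwa [uIcc_of_le hab] at hsm'), ← hAsymm (y' s) (Y s),
    real_inner_comm (A (y' s)) (Y s)]
  ring

lemma potential {G : X → ℝ} {g : X → X} (hG : ∀ x, HasGradientAt G (g x) x) (hg : Continuous g)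
    {a b : ℝ} (hab : a ≤ b) {v v' : ℝ → X}
    (hv : ∀ s ∈ Icc a b, HasDerivWithinAt v (v' s) (Icc a b) s) (hv' : ContinuousOn v' (Icc a b)) :
    ∫ s in a..b, ⟪g (v s), v' s⟫ = G (v b) - G (v a) := by
  have hvc : ContinuousOn v (Icc a b) := fun s hs => (hv s hs).continuousWithinAt
  have hGc : Continuous G := continuous_iff_continuousAt.2 fun x => (hG x).continuousAt
  apply intervalIntegral.integral_eq_sub_of_hasDerivAt_of_le (f := fun s => G (v s)) hab
  · exact hGc.comp_continuousOn hvc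
  · intro s hs
    have h1 := (hv s (Ioo_subset_Icc_self hs)).hasDerivAt (Icc_mem_nhds hs.1 hs.2)
    have h2 := (hG (v s)).hasFDerivAt.comp_hasDerivAt s h1
    simp only [InnerProductSpace.toDual_apply_apply] at h2
    exact h2
  · apply ContinuousOn.intervalIntegrable
    rw [uIcc_of_le hab]
    exact (hg.comp_continuousOn hvc).inner hv'

/-- positive definite operators are coercive -/
lemma posdef_coercive (Q : X →L[ℝ] X) (hQ : ∀ x : X, x ≠ 0 → 0 < ⟪x, Q x⟫) :
    ∃ β > (0 : ℝ), ∀ x, β * ‖x‖ ^ 2 ≤ ⟪x, Q x⟫ := by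
  by_cases hne : (Metric.sphere (0 : X) 1).Nonempty
  · have hc : ContinuousOn (fun x : X => ⟪x, Q x⟫) (Metric.sphere (0 : X) 1) := by fun_prop
    obtain ⟨u, hu, hmin⟩ := (isCompact_sphere (0 : X) 1).exists_isMinOn hne hc
    have hu0 : u ≠ 0 := by
      rintro rfl; simp at hu
    refine ⟨⟪u, Q u⟫, hQ u hu0, fun x => ?_⟩
    by_cases hx : x = 0
    · simp [hx]
    have hnx : ‖x‖ ≠ 0 := norm_ne_zero_iff.2 hx
    have hm : (‖x‖⁻¹ • x) ∈ Metric.sphere (0 : X) 1 := by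
      simp [norm_smul, hnx]
    have h1 : ⟪u, Q u⟫ ≤ ⟪‖x‖⁻¹ • x, Q (‖x‖⁻¹ • x)⟫ := hmin hm
    rw [map_smul, real_inner_smul_left, real_inner_smul_right] at h1
    have h2 : ‖x‖⁻¹ * (‖x‖⁻¹ * ⟪x, Q x⟫) * ‖x‖ ^ 2 = ⟪x, Q x⟫ := by
      field_simp
    calc ⟪u, Q u⟫ * ‖x‖ ^ 2 ≤ ‖x‖⁻¹ * (‖x‖⁻¹ * ⟪x, Q x⟫) * ‖x‖ ^ 2 := by gcongr
      _ = _ := h2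
  · refine ⟨1, one_pos, fun x => ?_⟩
    have hx : x = 0 := by
      by_contra hx
      exact hne ⟨‖x‖⁻¹ • x, by simp [norm_smul, norm_ne_zero_iff.2 hx]⟩
    simp [hx]

/-- Sublevel sets of `F t` are bounded. -/
lemma sublevel_bounded {T : ℝ} {F dtF : ℝ → X → ℝ}
    (hdtF : ∀ x : X, ∀ t ∈ Set.Icc 0 T,
      HasDerivWithinAt (fun τ => F τ x) (dtF t x) (Set.Icc 0 T) t)
    (hF1 : ∀ ρ > (0 : ℝ), Bornology.IsBounded {x : X | ∀ t ∈ Set.Icc 0 T, |F t x| ≤ ρ})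
    {C₁ C₂ : ℝ} (hC₁ : 0 < C₁) (hC₂ : 0 < C₂)
    (hF2 : ∀ t ∈ Set.Icc 0 T, ∀ x : X, |dtF t x| ≤ C₁ * F t x + C₂)
    {t : ℝ} (ht : t ∈ Icc 0 T) (ρ : ℝ) : Bornology.IsBounded {x : X | F t x ≤ ρ} := by
  set P : ℝ := (C₁ * |ρ| + C₂) * Real.exp (C₁ * T) with hP
  have hP0 : 0 < P := by positivity
  refine (hF1 ((P + C₂) / C₁) (by positivity)).subset fun x hx => ?_
  intro τ hτ
  have hx : F t x ≤ ρ := hx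
  have hG0 : ∀ s ∈ Icc 0 T, 0 ≤ C₁ * F s x + C₂ := fun s hs => (abs_nonneg _).trans (hF2 s hs x)
  have hGt : C₁ * F t x + C₂ ≤ C₁ * |ρ| + C₂ := by
    have := mul_le_mul_of_nonneg_left (hx.trans (le_abs_self ρ)) hC₁.le
    linarith
  have hexp : ∀ k s, HasDerivAt (fun s : ℝ => Real.exp (k * s)) (k * Real.exp (k * s)) s := by
    intro k s
    have := ((hasDerivAt_id s).const_mul k).exp
    simp only [id, mul_one] at this
    rw [mul_comm]; exact this
  have hder : ∀ k, ∀ s ∈ Icc 0 T, HasDerivWithinAt (fun s => (C₁ * F s x + C₂) * Real.exp (k * s))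
      ((C₁ * dtF s x) * Real.exp (k * s) + (C₁ * F s x + C₂) * (k * Real.exp (k * s)))
      (Icc 0 T) s := by
    intro k s hs
    exact (((hdtF x s hs).const_mul C₁).add_const C₂).mul (hexp k s).hasDerivWithinAt
  have hcon : ∀ k, ContinuousOn (fun s => (C₁ * F s x + C₂) * Real.exp (k * s)) (Icc 0 T) :=
    fun k s hs => (hder k s hs).continuousWithinAt
  have hanti : AntitoneOn (fun s => (C₁ * F s x + C₂) * Real.exp (-C₁ * s)) (Icc 0 T) := by
    refine antitoneOn_of_hasDerivWithinAt_nonpos (convex_Icc 0 T) (hcon _)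
      (fun s hs => (hder _ s (interior_subset hs)).mono interior_subset) fun s hs => ?_
    have h1 := (abs_le.1 (hF2 s (interior_subset hs) x)).2
    have h2 := Real.exp_pos (-C₁ * s)
    have : C₁ * dtF s x * Real.exp (-C₁ * s) + (C₁ * F s x + C₂) * (-C₁ * Real.exp (-C₁ * s))
      = -(C₁ * Real.exp (-C₁ * s) * ((C₁ * F s x + C₂) - dtF s x)) := by ring
    rw [this]
    have : 0 ≤ C₁ * Real.exp (-C₁ * s) * ((C₁ * F s x + C₂) - dtF s x) :=
      mul_nonneg (by positivity) (by linarith)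
    linarith
  have hmono : MonotoneOn (fun s => (C₁ * F s x + C₂) * Real.exp (C₁ * s)) (Icc 0 T) := by
    refine monotoneOn_of_hasDerivWithinAt_nonneg (convex_Icc 0 T) (hcon _)
      (fun s hs => (hder _ s (interior_subset hs)).mono interior_subset) fun s hs => ?_
    have h1 := (abs_le.1 (hF2 s (interior_subset hs) x)).1
    have h2 := Real.exp_pos (C₁ * s)
    have : C₁ * dtF s x * Real.exp (C₁ * s) + (C₁ * F s x + C₂) * (C₁ * Real.exp (C₁ * s))
      = (C₁ * Real.exp (C₁ * s) * ((C₁ * F s x + C₂) + dtF s x)) := by ring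
    rw [this]
    exact mul_nonneg (by positivity) (by linarith)
  have hGτ : C₁ * F τ x + C₂ ≤ P := by
    have hkey : ∀ d : ℝ, d ≤ C₁ * T → C₁ * F τ x + C₂ ≤ (C₁ * F t x + C₂) * Real.exp d →
        C₁ * F τ x + C₂ ≤ P := by
      intro d hd h
      refine h.trans ?_
      exact mul_le_mul hGt (Real.exp_le_exp.2 hd) (Real.exp_pos _).le (by positivity)
    rcases le_total t τ with h | h
    · have h1 : (C₁ * F τ x + C₂) * Real.exp (-C₁ * τ) ≤ (C₁ * F t x + C₂) * Real.exp (-C₁ * t) :=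
        hanti ht hτ h
      refine hkey (C₁ * τ - C₁ * t) (by nlinarith [hτ.2, ht.1]) ?_
      have h2 := mul_le_mul_of_nonneg_right h1 (Real.exp_pos (C₁ * τ)).le
      rw [mul_assoc, ← Real.exp_add, mul_assoc, ← Real.exp_add] at h2
      have h3 : -C₁ * τ + C₁ * τ = 0 := by ring
      have h4 : -C₁ * t + C₁ * τ = C₁ * τ - C₁ * t := by ring
      rw [h3, h4, Real.exp_zero, mul_one] at h2
      exact h2
    · have h1 : (C₁ * F τ x + C₂) * Real.exp (C₁ * τ) ≤ (C₁ * F t x + C₂) * Real.exp (C₁ * t) :=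
        hmono hτ ht h
      refine hkey (C₁ * t - C₁ * τ) (by nlinarith [hτ.1, ht.2]) ?_
      have h2 := mul_le_mul_of_nonneg_right h1 (Real.exp_pos (-C₁ * τ)).le
      rw [mul_assoc, ← Real.exp_add, mul_assoc, ← Real.exp_add] at h2
      have h3 : C₁ * τ + -C₁ * τ = 0 := by ring
      have h4 : C₁ * t + -C₁ * τ = C₁ * t - C₁ * τ := by ring
      rw [h3, h4, Real.exp_zero, mul_one] at h2
      exact h2
  have := hG0 τ hτ
  rw [abs_le, le_div_iff₀ hC₁, neg_le_iff_add_nonneg]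
  constructor
  · have : F τ x + (P + C₂) / C₁ = (C₁ * F τ x + C₂ + P) / C₁ := by field_simp; ring
    rw [this]; positivity
  · linarith

end Analysis

lemma clamp_lip (N a b : ℝ) (hN : 0 ≤ N) :
    |max (-N) (min N b) - max (-N) (min N a)| ≤ |b - a| ∧
    |(b - a) - (max (-N) (min N b) - max (-N) (min N a))| ≤ |b - a| := by
  constructor <;> rcases le_total N b with h1 | h1 <;> rcases le_total N a with h2 | h2 <;>
  rcases le_total (-N) b with h3 | h3 <;> rcases le_total (-N) a with h4 | h4 <;>
  rcases le_total a b with h5 | h5 <;>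
  simp only [min_eq_left, min_eq_right, max_eq_left, max_eq_right, h1, h2, h3, h4,
    neg_le_self hN] <;>
  first
  | exact le_rfl
  | rw [abs_of_nonneg (sub_nonneg.2 h5), abs_le]; constructor <;> linarith
  | rw [abs_of_nonpos (sub_nonpos.2 h5), abs_le]; constructor <;> linarith

/-- a path with small residual gives an approximate trajectory -/
lemma approx_of_integral {Z : Type*} [NormedAddCommGroup Z] [NormedSpace ℝ Z] [CompleteSpace Z]
    [ProperSpace Z] {f : Z → Z} {M K δ N : ℝ} {L : NNReal}
    (hf : LipschitzOnWith L f (Metric.closedBall 0 M))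
    (hK : ∀ x ∈ Metric.closedBall (0 : Z) M, ‖f x‖ ≤ K) (hN : 0 ≤ N) (hδ : 0 < δ)
    {z ρ : ℝ → Z} (hzc : ContinuousOn z (Icc (-N) N))
    (hzm : ∀ s ∈ Icc (-N) N, z s ∈ Metric.closedBall (0 : Z) M)
    (hρ : IntervalIntegrable ρ volume (-N) N)
    (hρ2 : IntervalIntegrable (fun s => ‖ρ s‖ ^ 2) volume (-N) N)
    (hρδ : ∫ s in (-N)..N, ‖ρ s‖ ^ 2 ≤ δ ^ 2)
    (hz : ∀ a ∈ Icc (-N) N, ∀ b ∈ Icc (-N) N, z b - z a = ∫ s in a..b, (f (z s) + ρ s))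
    (h1 : f (z (-N)) = 0) (h2 : f (z N) = 0) :
    Approx f M (2 * L * K) ((2 * L + 1) * δ) (fun s => z (max (-N) (min N s))) := by
  have hNN : -N ≤ N := by linarith
  have hcl : ∀ s, max (-N) (min N s) ∈ Icc (-N) N := fun s =>
    ⟨le_max_left _ _, max_le hNN (min_le_left _ _)⟩
  have hL : (0 : ℝ) ≤ L := L.2
  have hKn : 0 ≤ K := (norm_nonneg _).trans (hK _ (hzm N ⟨hNN, le_rfl⟩))
  have hsub : ∀ a ∈ Icc (-N) N, ∀ b ∈ Icc (-N) N, uIcc a b ⊆ uIcc (-N) N := by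
    intro a ha b hb
    rw [uIcc_of_le hNN]
    exact uIcc_subset_Icc ha hb
  have hsub' : ∀ a ∈ Icc (-N) N, ∀ b ∈ Icc (-N) N, ∀ s ∈ uIoc a b, s ∈ Icc (-N) N := by
    intro a ha b hb s hs
    exact uIcc_subset_Icc ha hb (uIoc_subset_uIcc hs)
  -- residual integral
  have hres : ∀ a ∈ Icc (-N) N, ∀ b ∈ Icc (-N) N, |b - a| ≤ 1 → |∫ s in a..b, ‖ρ s‖| ≤ δ := by
    intro a ha b hb hab
    have hi := hρ2.mono_set (hsub a ha b hb)
    have e1 : ‖∫ s in a..b, ‖ρ s‖‖ ≤ |∫ s in a..b, (δ / 2 + (1 / (2 * δ)) * ‖ρ s‖ ^ 2)| := by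
      apply intervalIntegral.norm_integral_le_abs_of_norm_le
      · refine Eventually.of_forall fun s => ?_
        rw [norm_norm]
        have : δ / 2 + (1 / (2 * δ)) * ‖ρ s‖ ^ 2 - ‖ρ s‖ = (‖ρ s‖ - δ) ^ 2 / (2 * δ) := by
          field_simp; ring
        have h0 : 0 ≤ (‖ρ s‖ - δ) ^ 2 / (2 * δ) := by positivity
        linarith
      · exact (intervalIntegrable_const).add (hi.const_mul _)
    rw [intervalIntegral.integral_add intervalIntegrable_const (hi.const_mul _),
      intervalIntegral.integral_const, intervalIntegral.integral_const_mul] at e1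
    have e2 : |∫ s in a..b, ‖ρ s‖ ^ 2| ≤ δ ^ 2 := by
      refine (intervalIntegral.abs_integral_mono_interval (c := -N) (d := N) ?_
        (Eventually.of_forall fun s => by positivity) hρ2).trans ?_
      · rw [uIoc_of_le hNN]
        intro s hs
        rcases le_total a b with h | h
        · rw [uIoc_of_le h] at hs; exact ⟨ha.1.trans_lt hs.1, hs.2.trans hb.2⟩
        · rw [uIoc_of_ge h] at hs; exact ⟨hb.1.trans_lt hs.1, hs.2.trans ha.2⟩
      · rwa [abs_of_nonneg]
        exact intervalIntegral.integral_nonneg hNN fun s _ => by positivity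
    rw [Real.norm_eq_abs] at e1
    refine e1.trans ((abs_add_le _ _).trans ?_)
    rw [smul_eq_mul, abs_mul, abs_mul, abs_of_pos (by positivity : 0 < δ / 2),
      abs_of_pos (by positivity : 0 < 1 / (2 * δ))]
    have e3 : |b - a| * (δ / 2) ≤ 1 * (δ / 2) := by gcongr
    have e4 : 1 / (2 * δ) * |∫ s in a..b, ‖ρ s‖ ^ 2| ≤ 1 / (2 * δ) * δ ^ 2 := by gcongr
    have e5 : 1 / (2 * δ) * δ ^ 2 = δ / 2 := by field_simp
    linarith
  have hcint : ∀ c : ℝ, 0 ≤ c → ∀ a ∈ Icc (-N) N, ∀ b ∈ Icc (-N) N, |b - a| ≤ 1 →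
      |∫ s in a..b, (c + ‖ρ s‖)| ≤ c * |b - a| + δ := by
    intro c hc a ha b hb hab
    rw [intervalIntegral.integral_add intervalIntegrable_const
      (hρ.mono_set (hsub a ha b hb)).norm, intervalIntegral.integral_const]
    refine (abs_add_le _ _).trans ?_
    rw [smul_eq_mul, abs_mul, abs_of_nonneg hc, mul_comm]
    linarith [hres a ha b hb hab]
  have hci : ∀ c : ℝ, ∀ a ∈ Icc (-N) N, ∀ b ∈ Icc (-N) N,
      IntervalIntegrable (fun s => c + ‖ρ s‖) volume a b := fun c a ha b hb =>
    intervalIntegrable_const.add (hρ.mono_set (hsub a ha b hb)).norm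
  have hhol : ∀ a ∈ Icc (-N) N, ∀ b ∈ Icc (-N) N, |b - a| ≤ 1 →
      ‖z b - z a‖ ≤ K * |b - a| + δ := by
    intro a ha b hb hab
    rw [hz a ha b hb]
    refine (intervalIntegral.norm_integral_le_abs_of_norm_le ?_ (hci K a ha b hb)).trans
      (hcint K hKn a ha b hb hab)
    rw [ae_restrict_iff' measurableSet_uIoc]
    refine Eventually.of_forall fun s hs => ?_
    exact (norm_add_le _ _).trans (by gcongr; exact hK _ (hzm s (hsub' a ha b hb s hs)))
  have hfl : ∀ a ∈ Icc (-N) N, ∀ b ∈ Icc (-N) N, |b - a| ≤ 1 →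
      ‖f (z b) - f (z a)‖ ≤ L * (K * |b - a| + δ) := by
    intro a ha b hb hab
    refine (hf.norm_sub_le (hzm b hb) (hzm a ha)).trans ?_
    gcongr
    exact hhol a ha b hb hab
  have hmain : ∀ a ∈ Icc (-N) N, ∀ b ∈ Icc (-N) N, |b - a| ≤ 1 →
      ‖z b - z a - (b - a) • f (z a)‖ ≤ L * (K * |b - a| + δ) * |b - a| + δ := by
    intro a ha b hb hab
    have hfi : IntervalIntegrable (fun s => f (z s)) volume a b := by
      apply ContinuousOn.intervalIntegrable
      refine (hf.continuousOn.comp hzc hzm).mono ?_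
      exact uIcc_subset_Icc ha hb
    have : z b - z a - (b - a) • f (z a) = ∫ s in a..b, (f (z s) + ρ s - f (z a)) := by
      rw [intervalIntegral.integral_sub (hfi.add (hρ.mono_set (hsub a ha b hb)))
        intervalIntegrable_const, ← hz a ha b hb, intervalIntegral.integral_const]
    rw [this]
    have hnn : 0 ≤ L * (K * |b - a| + δ) := by positivity
    refine (intervalIntegral.norm_integral_le_abs_of_norm_le ?_ (hci _ a ha b hb)).trans
      (hcint _ hnn a ha b hb hab)
    rw [ae_restrict_iff' measurableSet_uIoc]
    refine Eventually.of_forall fun s hs => ?_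
    have hsm := hsub' a ha b hb s hs
    have hsa : |s - a| ≤ |b - a| := by
      have := uIoc_subset_uIcc hs
      exact abs_sub_left_of_mem_uIcc this
    have e1 : f (z s) + ρ s - f (z a) = (f (z s) - f (z a)) + ρ s := by abel
    rw [e1]
    refine (norm_add_le _ _).trans ?_
    gcongr
    refine (hfl a ha s hsm (hsa.trans hab)).trans ?_
    gcongr
  refine ⟨?_, fun s => hzm _ (hcl s), ?_⟩
  · rw [← continuousOn_univ]
    exact hzc.comp (by fun_prop) fun s _ => hcl s
  · intro a b hab
    obtain ⟨hc1, hc2⟩ := clamp_lip N a b hN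
    set a' := max (-N) (min N a) with ha'
    set b' := max (-N) (min N b) with hb'
    have ha := hcl a
    have hb := hcl b
    have hab' := hc1.trans hab
    have key : ‖((b - a) - (b' - a')) • f (z a')‖ ≤ |b - a| * (L * (K * |b - a| + δ)) := by
      have hnn : 0 ≤ |b - a| * (L * (K * |b - a| + δ)) := by positivity
      by_cases hfa : f (z a') = 0
      · rw [hfa, smul_zero, norm_zero]; exact hnn
      by_cases hfb : f (z b') = 0
      · rw [norm_smul, Real.norm_eq_abs]
        have := hfl a' ha b' hb hab'
        rw [hfb, zero_sub, norm_neg] at this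
        have h3 : (L:ℝ) * (K * |b' - a'| + δ) ≤ L * (K * |b - a| + δ) := by gcongr
        exact mul_le_mul hc2 (this.trans h3) (norm_nonneg _) (abs_nonneg _)
      have hin : ∀ s, f (z (max (-N) (min N s))) ≠ 0 → max (-N) (min N s) = s := by
        intro s hs
        rcases le_total N s with h | h
        · rw [min_eq_left h, max_eq_right hNN] at hs; exact absurd h2 hs
        rcases le_total s (-N) with h' | h'
        · rw [min_eq_right h, max_eq_left h'] at hs; exact absurd h1 hs
        rw [min_eq_right h, max_eq_right h']
      rw [ha', hb', hin a hfa, hin b hfb, sub_self, zero_smul, norm_zero]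
      exact hnn
    have e1 : z b' - z a' - (b - a) • f (z a') = (z b' - z a' - (b' - a') • f (z a'))
        - ((b - a) - (b' - a')) • f (z a') := by
      rw [sub_smul (b - a) (b' - a')]; abel
    have e2 := hmain a' ha b' hb hab'
    have e3 : (L:ℝ) * (K * |b' - a'| + δ) * |b' - a'| ≤ L * (K * |b - a| + δ) * |b - a| := by
      gcongr
    show ‖z b' - z a' - (b - a) • f (z a')‖ ≤ _
    rw [e1]
    refine (norm_sub_le _ _).trans ?_
    have e4 : (L:ℝ) * δ * |b - a| ≤ L * δ * 1 := by gcongr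
    have e5 : (b - a) ^ 2 = |b - a| ^ 2 := (sq_abs _).symm
    rw [e5]
    nlinarith

section Concrete

variable {X : Type*} [NormedAddCommGroup X] [InnerProductSpace ℝ X] [FiniteDimensional ℝ X]

/-- the phase-space vector field -/
def vf (Ainv B : X →L[ℝ] X) (g : X → X) : X × X → X × X :=
  fun z => (z.2, -Ainv (B z.2 + g z.1))

/-- the total energy -/
noncomputable def En (A : X →L[ℝ] X) (G : X → ℝ) : X × X → ℝ :=
  fun z => 1 / 2 * ⟪z.2, A z.2⟫ + G z.1

lemma vf_eq_zero {A Ainv B : X →L[ℝ] X} (hA2 : ∀ x, A (Ainv x) = x) {g : X → X} {z : X × X} :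
    vf Ainv B g z = 0 ↔ z.2 = 0 ∧ g z.1 = 0 := by
  constructor
  · intro h
    have h1 : z.2 = 0 := congrArg Prod.fst h
    have h2 : -Ainv (B z.2 + g z.1) = 0 := congrArg Prod.snd h
    refine ⟨h1, ?_⟩
    rw [h1, map_zero, zero_add, neg_eq_zero] at h2
    rw [← hA2 (g z.1), h2, map_zero]
  · rintro ⟨h1, h2⟩
    simp [vf, h1, h2]

lemma En_deriv {A Ainv B : X →L[ℝ] X} (hAsymm : ∀ x y : X, ⟪A x, y⟫ = ⟪x, A y⟫)
    (hA2 : ∀ x, A (Ainv x) = x) {G : X → ℝ} {g : X → X}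
    (hG : ∀ x, HasGradientAt G (g x) x) {w : ℝ → X × X}
    (hw : ∀ s, HasDerivAt w (vf Ainv B g (w s)) s) (s : ℝ) :
    HasDerivAt (fun s => En A G (w s)) (-⟪(w s).2, B (w s).2⟫) s := by
  have h1 : HasDerivAt (fun s => (w s).1) (w s).2 s := (hw s).fst
  have h2 : HasDerivAt (fun s => (w s).2) (-Ainv (B (w s).2 + g (w s).1)) s := (hw s).snd
  have h3 := A.hasFDerivAt.comp_hasDerivAt s h2
  have h4 := (h2.inner ℝ h3).const_mul (1 / 2)
  have h5 := (hG (w s).1).hasFDerivAt.comp_hasDerivAt s h1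
  simp only [InnerProductSpace.toDual_apply_apply] at h5
  have h6 := h4.add h5
  refine h6.congr_deriv ?_
  set y := (w s).2
  set x := (w s).1
  have e1 : ⟪-Ainv (B y + g x), A y⟫ = -⟪B y + g x, y⟫ := by
    rw [← hAsymm, map_neg, hA2, inner_neg_left]
  have e2 : ⟪y, A (-Ainv (B y + g x))⟫ = -⟪B y + g x, y⟫ := by
    rw [map_neg, hA2, inner_neg_right, real_inner_comm]
  simp only [Function.comp] at e1 e2 ⊢
  rw [e1, e2, inner_add_left, real_inner_comm y (B y)]
  ring

lemma memLp_of_continuousOn {Y : Type*} [NormedAddCommGroup Y] [SecondCountableTopology Y]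
    {a b : ℝ} {h : ℝ → Y}
    (hc : ContinuousOn h (Icc a b)) : MemLp h 2 (volume.restrict (Icc a b)) := by
  obtain ⟨C, hC⟩ := isCompact_Icc.exists_bound_of_continuousOn hc
  refine MemLp.of_bound (hc.aestronglyMeasurable measurableSet_Icc) C ?_
  rw [ae_restrict_iff' measurableSet_Icc]
  exact Eventually.of_forall hC

lemma quad_integrable (Q : X →L[ℝ] X) {μ : Measure ℝ} {r : ℝ → X} (hr : MemLp r 2 μ) :
    Integrable (fun s => ⟪r s, Q (r s)⟫) μ := by
  have h1 := (memLp_two_iff_integrable_sq_norm hr.1).1 hr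
  refine (h1.const_mul ‖Q‖).mono' ?_ (Eventually.of_forall fun s => ?_)
  · exact hr.1.inner (Q.continuous.comp_aestronglyMeasurable hr.1)
  · calc ‖⟪r s, Q (r s)⟫‖ ≤ ‖r s‖ * ‖Q (r s)‖ := norm_inner_le_norm _ _
      _ ≤ ‖r s‖ * (‖Q‖ * ‖r s‖) := by gcongr; exact Q.le_opNorm _
      _ = ‖Q‖ * ‖r s‖ ^ 2 := by ring

lemma path_energy {A B Binv : X →L[ℝ] X}
    (hAsymm : ∀ x y : X, ⟪A x, y⟫ = ⟪x, A y⟫) (hBsymm : ∀ x y : X, ⟪B x, y⟫ = ⟪x, B y⟫)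
    (hBinv₁ : ∀ x : X, Binv (B x) = x) (hBinv₂ : ∀ x : X, B (Binv x) = x)
    {G : X → ℝ} {g : X → X} (hG : ∀ x, HasGradientAt G (g x) x) (hg : Continuous g)
    {a b : ℝ} (hab : a ≤ b) {v v' v'' : ℝ → X}
    (hv : ∀ s ∈ Icc a b, HasDerivWithinAt v (v' s) (Icc a b) s)
    (hv' : ContinuousOn v' (Icc a b))
    (hv''2 : MemLp v'' 2 (volume.restrict (Icc a b)))
    (hvv : ∀ s ∈ Icc a b, v' s = v' a + ∫ r in a..s, v'' r) :
    ∫ s in a..b, ⟪g (v s) + A (v'' s) + B (v' s), Binv (g (v s) + A (v'' s) + B (v' s))⟫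
      = (∫ s in a..b, (⟪g (v s) + A (v'' s), Binv (g (v s) + A (v'' s))⟫ + ⟪v' s, B (v' s)⟫))
        + 2 * (En A G (v b, v' b) - En A G (v a, v' a)) := by
  have hvc : ContinuousOn v (Icc a b) := fun s hs => (hv s hs).continuousWithinAt
  have hgv : ContinuousOn (fun s => g (v s)) (Icc a b) := hg.comp_continuousOn hvc
  have hyint : IntervalIntegrable v'' volume a b :=
    (intervalIntegrable_iff_integrableOn_Icc_of_le hab).2 (hv''2.integrable (by norm_num))
  have hk := kinetic A hAsymm hab hyint hvv
  have hp := potential hG hg hab hv hv'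
  have hh : MemLp (fun s => g (v s) + A (v'' s)) 2 (volume.restrict (Icc a b)) :=
    (memLp_of_continuousOn hgv).add (A.comp_memLp' hv''2)
  have hI : IntervalIntegrable (fun s => ⟪g (v s) + A (v'' s), Binv (g (v s) + A (v'' s))⟫
      + ⟪v' s, B (v' s)⟫) volume a b :=
    (intervalIntegrable_iff_integrableOn_Icc_of_le hab).2
      ((quad_integrable Binv hh).add (quad_integrable B (memLp_of_continuousOn hv')))
  have hI2 : IntervalIntegrable (fun s => ⟪g (v s), v' s⟫) volume a b := by
    apply ContinuousOn.intervalIntegrable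
    rw [uIcc_of_le hab]
    exact hgv.inner hv'
  have hI3 : IntervalIntegrable (fun s => 2 * ⟪A (v'' s), v' s⟫) volume a b := by
    apply IntervalIntegrable.const_mul
    rw [intervalIntegrable_iff_integrableOn_Icc_of_le hab]
    obtain ⟨C, hC⟩ := isCompact_Icc.exists_bound_of_continuousOn hv'
    have h1 : Integrable (fun s => A (v'' s)) (volume.restrict (Icc a b)) :=
      A.integrable_comp (hv''2.integrable (by norm_num))
    refine (h1.norm.const_mul C).mono'
      (h1.1.inner (hv'.aestronglyMeasurable measurableSet_Icc)) ?_
    rw [ae_restrict_iff' measurableSet_Icc]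
    refine Eventually.of_forall fun s hs => ?_
    calc ‖⟪A (v'' s), v' s⟫‖ ≤ ‖A (v'' s)‖ * ‖v' s‖ := norm_inner_le_norm _ _
      _ ≤ ‖A (v'' s)‖ * C := by gcongr; exact hC s hs
      _ = C * ‖A (v'' s)‖ := mul_comm _ _
  have hpt : ∀ s, ⟪g (v s) + A (v'' s) + B (v' s), Binv (g (v s) + A (v'' s) + B (v' s))⟫
      = (⟪g (v s) + A (v'' s), Binv (g (v s) + A (v'' s))⟫ + ⟪v' s, B (v' s)⟫)
        + (2 * ⟪g (v s), v' s⟫ + 2 * ⟪A (v'' s), v' s⟫) := by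
    intro s
    set h := g (v s) + A (v'' s) with hhdef
    have e1 : ⟪B (v' s), Binv h⟫ = ⟪h, v' s⟫ := by
      rw [hBsymm, hBinv₂, real_inner_comm]
    rw [map_add, hBinv₁, inner_add_left, inner_add_right, inner_add_right, e1,
      real_inner_comm (v' s) (B (v' s)), hhdef, inner_add_left (g (v s)) (A (v'' s)) (v' s)]
    ring
  rw [intervalIntegral.integral_congr (fun s _ => hpt s),
    intervalIntegral.integral_add hI ((hI2.const_mul 2).add hI3),
    intervalIntegral.integral_add (hI2.const_mul 2) hI3, intervalIntegral.integral_const_mul,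
    hk, hp]
  simp only [En]
  ring

lemma approx_of_path {A Ainv B Binv : X →L[ℝ] X}
    (hA1 : ∀ x, Ainv (A x) = x) (hA2 : ∀ x, A (Ainv x) = x)
    (hAsymm : ∀ x y : X, ⟪A x, y⟫ = ⟪x, A y⟫) (hBsymm : ∀ x y : X, ⟪B x, y⟫ = ⟪x, B y⟫)
    (hBpos : ∀ x : X, 0 ≤ ⟪x, B x⟫)
    (hBinv₁ : ∀ x : X, Binv (B x) = x) (hBinv₂ : ∀ x : X, B (Binv x) = x)
    {β : ℝ} (hβ : 0 < β) (hβB : ∀ x : X, β * ‖x‖ ^ 2 ≤ ⟪x, Binv x⟫)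
    {G : X → ℝ} {g : X → X} (hG : ∀ x, HasGradientAt G (g x) x) (hg : Continuous g)
    {p q : X} (hp : g p = 0) (hq : g q = 0) {M K δ κ : ℝ} {L : NNReal}
    (hM : ∀ z : X × X, En A G z ≤ G p + 1 → z ∈ Metric.closedBall (0 : X × X) M)
    (hf : LipschitzOnWith L (vf Ainv B g) (Metric.closedBall 0 M))
    (hK : ∀ x ∈ Metric.closedBall (0 : X × X) M, ‖vf Ainv B g x‖ ≤ K)
    (hδ : 0 < δ) (hκ1 : κ ≤ 1) (hκ : ‖Ainv‖ ^ 2 / β * (2 * κ) ≤ δ ^ 2)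
    {N : ℝ} (hN : 0 ≤ N) {v v' v'' : ℝ → X}
    (hv : ∀ s ∈ Icc (-N) N, HasDerivWithinAt v (v' s) (Icc (-N) N) s)
    (hv' : ContinuousOn v' (Icc (-N) N))
    (hv''2 : MemLp v'' 2 (volume.restrict (Icc (-N) N)))
    (hvv : ∀ s ∈ Icc (-N) N, v' s = v' (-N) + ∫ r in (-N)..s, v'' r)
    (h1 : v (-N) = p) (h2 : v N = q) (h3 : v' (-N) = 0) (h4 : v' N = 0)
    (hc : (1 / 2) * ∫ s in (-N)..N,
      (⟪g (v s) + A (v'' s), Binv (g (v s) + A (v'' s))⟫ + ⟪v' s, B (v' s)⟫) ≤ G p - G q + κ) :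
    ∃ z, Approx (vf Ainv B g) M (2 * L * K) ((2 * L + 1) * δ) z ∧ (∃ s, z s = (p, 0)) ∧
      ∃ S, ∀ s ≥ S, z s = (q, 0) := by
  have hNN : -N ≤ N := by linarith
  have hvc : ContinuousOn v (Icc (-N) N) := fun s hs => (hv s hs).continuousWithinAt
  have hgv : ContinuousOn (fun s => g (v s)) (Icc (-N) N) := hg.comp_continuousOn hvc
  set r : ℝ → X := fun s => g (v s) + A (v'' s) + B (v' s) with hr
  have hr2 : MemLp r 2 (volume.restrict (Icc (-N) N)) :=
    ((memLp_of_continuousOn hgv).add (A.comp_memLp' hv''2)).add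
      (B.comp_memLp' (memLp_of_continuousOn hv'))
  have hnn : ∀ x : X, 0 ≤ ⟪x, Binv x⟫ := fun x => le_trans (by positivity) (hβB x)
  have hri : IntervalIntegrable (fun s => ⟪r s, Binv (r s)⟫) volume (-N) N :=
    (intervalIntegrable_iff_integrableOn_Icc_of_le hNN).2 (quad_integrable Binv hr2)
  have hEn : ∀ x : X, En A G (x, 0) = G x := fun x => by simp [En]
  have hR : ∫ s in (-N)..N, ⟪r s, Binv (r s)⟫ ≤ 2 * κ := by
    have := path_energy hAsymm hBsymm hBinv₁ hBinv₂ hG hg hNN hv hv' hv''2 hvv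
    rw [h1, h2, h3, h4, hEn, hEn] at this
    simp only [hr]
    rw [this]
    linarith
  have hE : ∀ b ∈ Icc (-N) N, En A G (v b, v' b) ≤ G p + 1 := by
    intro b hb
    have hsub : Icc (-N) b ⊆ Icc (-N) N := Icc_subset_Icc_right hb.2
    have := path_energy hAsymm hBsymm hBinv₁ hBinv₂ hG hg hb.1
      (fun s hs => (hv s (hsub hs)).mono hsub) (hv'.mono hsub)
      (hv''2.mono_measure (Measure.restrict_mono hsub le_rfl)) (fun s hs => hvv s (hsub hs))
    rw [h1, h3, hEn] at this
    have e1 : ∫ s in (-N)..b, ⟪r s, Binv (r s)⟫ ≤ ∫ s in (-N)..N, ⟪r s, Binv (r s)⟫ :=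
      intervalIntegral.integral_mono_interval le_rfl hb.1 hb.2
        (Eventually.of_forall fun s => hnn _) hri
    have e2 : 0 ≤ ∫ s in (-N)..b, (⟪g (v s) + A (v'' s), Binv (g (v s) + A (v'' s))⟫
        + ⟪v' s, B (v' s)⟫) :=
      intervalIntegral.integral_nonneg hb.1 fun s _ => add_nonneg (hnn _) (hBpos _)
    simp only [hr] at e1 hR
    linarith
  set z : ℝ → X × X := fun s => (v s, v' s) with hz
  set ρ : ℝ → X × X := fun s => (0, Ainv (r s)) with hρ
  have hρn : ∀ s, ‖ρ s‖ = ‖Ainv (r s)‖ := fun s => by simp [hρ, Prod.norm_def]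
  have hAr2 : MemLp (fun s => Ainv (r s)) 2 (volume.restrict (Icc (-N) N)) :=
    Ainv.comp_memLp' hr2
  have hAri : IntegrableOn (fun s => Ainv (r s)) (Icc (-N) N) := hAr2.integrable (by norm_num)
  have hv''i : IntegrableOn v'' (Icc (-N) N) := hv''2.integrable (by norm_num)
  have hρi : IntegrableOn ρ (Icc (-N) N) :=
    (integrable_zero _ _ _).prodMk hAri
  have hρ2 : IntervalIntegrable (fun s => ‖ρ s‖ ^ 2) volume (-N) N := by
    rw [intervalIntegrable_iff_integrableOn_Icc_of_le hNN]
    simp only [hρn]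
    exact (memLp_two_iff_integrable_sq_norm hAr2.1).1 hAr2
  have hρδ : ∫ s in (-N)..N, ‖ρ s‖ ^ 2 ≤ δ ^ 2 := by
    have e1 : ∫ s in (-N)..N, ‖ρ s‖ ^ 2 ≤
        ∫ s in (-N)..N, ‖Ainv‖ ^ 2 / β * ⟪r s, Binv (r s)⟫ := by
      refine intervalIntegral.integral_mono hNN hρ2 (hri.const_mul _) fun s => ?_
      show ‖ρ s‖ ^ 2 ≤ ‖Ainv‖ ^ 2 / β * ⟪r s, Binv (r s)⟫
      rw [hρn]
      have e2 : ‖Ainv (r s)‖ ^ 2 ≤ (‖Ainv‖ * ‖r s‖) ^ 2 := by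
        gcongr; exact Ainv.le_opNorm _
      have e3 : ‖Ainv‖ ^ 2 / β * (β * ‖r s‖ ^ 2) ≤ ‖Ainv‖ ^ 2 / β * ⟪r s, Binv (r s)⟫ := by
        gcongr; exact hβB _
      have e4 : ‖Ainv‖ ^ 2 / β * (β * ‖r s‖ ^ 2) = (‖Ainv‖ * ‖r s‖) ^ 2 := by
        field_simp
      linarith
    rw [intervalIntegral.integral_const_mul] at e1
    have e5 : ‖Ainv‖ ^ 2 / β * ∫ s in (-N)..N, ⟪r s, Binv (r s)⟫ ≤ ‖Ainv‖ ^ 2 / β * (2 * κ) := by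
      gcongr
    linarith
  have hzd : ∀ s, vf Ainv B g (z s) + ρ s = (v' s, v'' s) := by
    intro s
    simp only [vf, hz, hρ, hr, Prod.mk_add_mk, add_zero, map_add, hA1]
    congr 1
    abel
  have hzint : ∀ a ∈ Icc (-N) N, ∀ b ∈ Icc (-N) N,
      z b - z a = ∫ s in a..b, (vf Ainv B g (z s) + ρ s) := by
    intro a ha b hb
    have hsub : uIcc a b ⊆ uIcc (-N) N := by
      rw [uIcc_of_le hNN]; exact uIcc_subset_Icc ha hb
    have i2 : ∀ a ∈ Icc (-N) N, ∀ b ∈ Icc (-N) N, IntervalIntegrable v'' volume a b := by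
      intro a ha b hb
      exact ((intervalIntegrable_iff_integrableOn_Icc_of_le hNN).2 hv''i).mono_set (by
        rw [uIcc_of_le hNN]; exact uIcc_subset_Icc ha hb)
    have i1 : ∀ a ∈ Icc (-N) N, ∀ b ∈ Icc (-N) N, IntervalIntegrable v' volume a b := by
      intro a ha b hb
      exact (hv'.mono (uIcc_subset_Icc ha hb)).intervalIntegrable
    have hmN : -N ∈ Icc (-N) N := ⟨le_rfl, hNN⟩
    simp only [hzd]
    have i3 : IntervalIntegrable (fun s => (v' s, v'' s)) volume a b :=
      ⟨(i1 a ha b hb).1.prodMk (i2 a ha b hb).1, (i1 a ha b hb).2.prodMk (i2 a ha b hb).2⟩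
    have c1 := (ContinuousLinearMap.fst ℝ X X).intervalIntegral_comp_comm i3
    have c2 := (ContinuousLinearMap.snd ℝ X X).intervalIntegral_comp_comm i3
    simp only [ContinuousLinearMap.coe_fst', ContinuousLinearMap.coe_snd'] at c1 c2
    have hv1 : ∀ b ∈ Icc (-N) N, ∫ s in (-N)..b, v' s = v b - v (-N) := by
      intro b hb
      have hsub : Icc (-N) b ⊆ Icc (-N) N := Icc_subset_Icc_right hb.2
      exact intervalIntegral.integral_eq_sub_of_hasDerivAt_of_le hb.1 (hvc.mono hsub)
        (fun s hs => (hv s (hsub (Ioo_subset_Icc_self hs))).hasDerivAt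
          (Icc_mem_nhds hs.1 (hs.2.trans_le hb.2))) (i1 _ hmN b hb)
    refine Prod.ext ?_ ?_
    · rw [← c1, ← intervalIntegral.integral_interval_sub_left (i1 _ hmN b hb) (i1 _ hmN a ha),
        hv1 b hb, hv1 a ha]
      simp [hz]
    · rw [← c2, ← intervalIntegral.integral_interval_sub_left (i2 _ hmN b hb) (i2 _ hmN a ha)]
      simp only [hz, Prod.snd_sub]
      rw [hvv b hb, hvv a ha]
      abel
  have hz1 : z (-N) = (p, 0) := by simp [hz, h1, h3]
  have hz2 : z N = (q, 0) := by simp [hz, h2, h4]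
  refine ⟨_, approx_of_integral hf hK hN hδ (z := z) (ρ := ρ) (hvc.prodMk hv')
    (fun s hs => hM _ (hE s hs))
    ((intervalIntegrable_iff_integrableOn_Icc_of_le hNN).2 hρi) hρ2 hρδ hzint ?_ ?_,
    ⟨-N, ?_⟩, N, fun s hs => ?_⟩
  · rw [hz1, vf_eq_zero hA2]; exact ⟨rfl, hp⟩
  · rw [hz2, vf_eq_zero hA2]; exact ⟨rfl, hq⟩
  · simp [min_eq_right hNN, hz1]
  · show z (max (-N) (min N s)) = _
    rw [min_eq_left hs, max_eq_right hNN, hz2]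

end Concrete

section Assembly

variable {X : Type*} [NormedAddCommGroup X] [InnerProductSpace ℝ X] [FiniteDimensional ℝ X]

lemma exists_inv (A : X →L[ℝ] X) (hApos : ∀ x : X, x ≠ 0 → 0 < ⟪x, A x⟫) :
    ∃ Ainv : X →L[ℝ] X, (∀ x, Ainv (A x) = x) ∧ ∀ x, A (Ainv x) = x := by
  have hinj : Function.Injective (A : X →ₗ[ℝ] X) := by
    rw [← LinearMap.ker_eq_bot, LinearMap.ker_eq_bot']
    intro x hx
    by_contra h
    have h1 := hApos x h
    have hx' : A x = 0 := hx
    rw [hx', inner_zero_right] at h1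
    exact lt_irrefl _ h1
  let e := LinearEquiv.ofInjectiveEndo (A : X →ₗ[ℝ] X) hinj
  refine ⟨LinearMap.toContinuousLinearMap (e.symm : X →ₗ[ℝ] X), fun x => ?_, fun x => ?_⟩
  · exact e.symm_apply_apply x
  · exact e.apply_symm_apply x

lemma vf_contDiff (Ainv B : X →L[ℝ] X) {g : X → X} (hg : ContDiff ℝ 1 g) :
    ContDiff ℝ 1 (vf Ainv B g) := by
  unfold vf
  have h1 : ContDiff ℝ 1 (fun z : X × X => g z.1) := hg.comp contDiff_fst
  have h2 : ContDiff ℝ 1 (fun z : X × X => B z.2) := B.contDiff.comp contDiff_snd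
  exact contDiff_snd.prodMk (Ainv.contDiff.comp (h2.add h1)).neg

lemma cost_set_nonempty (A B Binv : X →L[ℝ] X) (gradF : ℝ → X → X) (t : ℝ) (p q : X) :
    { c : ℝ | ∃ (N : ℕ) (v v' v'' : ℝ → X),
    (∀ s ∈ Set.Icc (-(N : ℝ)) (N : ℝ),
      HasDerivWithinAt v (v' s) (Set.Icc (-(N : ℝ)) (N : ℝ)) s) ∧
    ContinuousOn v' (Set.Icc (-(N : ℝ)) (N : ℝ)) ∧
    MeasureTheory.IntegrableOn v'' (Set.Icc (-(N : ℝ)) (N : ℝ)) ∧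
    MeasureTheory.IntegrableOn (fun s => ‖v'' s‖ ^ 2) (Set.Icc (-(N : ℝ)) (N : ℝ)) ∧
    (∀ s ∈ Set.Icc (-(N : ℝ)) (N : ℝ), v' s = v' (-(N : ℝ)) + ∫ r in (-(N : ℝ))..s, v'' r) ∧
    v (-(N : ℝ)) = p ∧ v (N : ℝ) = q ∧ v' (-(N : ℝ)) = 0 ∧ v' (N : ℝ) = 0 ∧
    c = (1 / 2) * ∫ s in (-(N : ℝ))..(N : ℝ),
      (⟪gradF t (v s) + A (v'' s), Binv (gradF t (v s) + A (v'' s))⟫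
        + ⟪v' s, B (v' s)⟫) }.Nonempty := by
  have hd1 : ∀ s : ℝ, HasDerivAt (fun s : ℝ => p + ((2 + 3 * s - s ^ 3) / 4) • (q - p))
      (((3 - 3 * s ^ 2) / 4) • (q - p)) s := by
    intro s
    have h : HasDerivAt (fun s : ℝ => (2 + 3 * s - s ^ 3) / 4) ((3 - 3 * s ^ 2) / 4) s := by
      have := ((((hasDerivAt_id s).const_mul 3).const_add 2).sub (hasDerivAt_pow 3 s)).div_const 4
      refine this.congr_deriv ?_
      norm_num
    exact (h.smul_const (q - p)).const_add p
  have hd2 : ∀ s : ℝ, HasDerivAt (fun s : ℝ => ((3 - 3 * s ^ 2) / 4) • (q - p))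
      ((-(6 * s) / 4) • (q - p)) s := by
    intro s
    have h : HasDerivAt (fun s : ℝ => (3 - 3 * s ^ 2) / 4) (-(6 * s) / 4) s := by
      have := (((hasDerivAt_pow 2 s).const_mul 3).const_sub 3).div_const 4
      refine this.congr_deriv ?_
      norm_num; ring
    exact h.smul_const (q - p)
  have hc2 : Continuous (fun s : ℝ => (-(6 * s) / 4) • (q - p)) := by fun_prop
  refine ⟨_, 1, fun s => p + ((2 + 3 * s - s ^ 3) / 4) • (q - p),
    fun s => ((3 - 3 * s ^ 2) / 4) • (q - p), fun s => (-(6 * s) / 4) • (q - p),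
    fun s _ => (hd1 s).hasDerivWithinAt, ?_, ?_, ?_, ?_, ?_, ?_, ?_, ?_, rfl⟩
  · exact Continuous.continuousOn (by fun_prop)
  · exact hc2.continuousOn.integrableOn_Icc
  · exact Continuous.integrableOn_Icc (by fun_prop)
  · intro s _
    rw [intervalIntegral.integral_eq_sub_of_hasDerivAt (fun x _ => hd2 x)
      (hc2.intervalIntegrable _ _)]
    abel
  · norm_num
  · norm_num
  · norm_num
  · norm_num

lemma approached_of_cost {A Ainv B Binv : X →L[ℝ] X}
    (hA1 : ∀ x, Ainv (A x) = x) (hA2 : ∀ x, A (Ainv x) = x)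
    (hAsymm : ∀ x y : X, ⟪A x, y⟫ = ⟪x, A y⟫) (hBsymm : ∀ x y : X, ⟪B x, y⟫ = ⟪x, B y⟫)
    (hBpos : ∀ x : X, 0 ≤ ⟪x, B x⟫)
    (hBinv₁ : ∀ x : X, Binv (B x) = x) (hBinv₂ : ∀ x : X, B (Binv x) = x)
    {β : ℝ} (hβ : 0 < β) (hβB : ∀ x : X, β * ‖x‖ ^ 2 ≤ ⟪x, Binv x⟫)
    {F : ℝ → X → ℝ} {gradF : ℝ → X → X} {t : ℝ}
    (hG : ∀ x, HasGradientAt (F t) (gradF t x) x) (hg : Continuous (gradF t))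
    {p q : X} (hp : gradF t p = 0) (hq : gradF t q = 0) {M K : ℝ} {L : NNReal}
    (hM : ∀ z : X × X, En A (F t) z ≤ F t p + 1 → z ∈ Metric.closedBall (0 : X × X) M)
    (hf : LipschitzOnWith L (vf Ainv B (gradF t)) (Metric.closedBall 0 M))
    (hK : ∀ x ∈ Metric.closedBall (0 : X × X) M, ‖vf Ainv B (gradF t) x‖ ≤ K)
    (hbal : F t p - F t q = cost A B Binv gradF t p q) :
    Approached (vf Ainv B (gradF t)) M (2 * L * K) (q, 0) (p, 0) := by
  intro ε hε
  have hL : (0 : ℝ) ≤ L := L.2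
  set δ : ℝ := ε / (2 * L + 1) with hδ
  have hδ0 : 0 < δ := by positivity
  set a : ℝ := ‖Ainv‖ ^ 2 / β with ha
  have ha0 : 0 ≤ a := by positivity
  set κ : ℝ := min 1 (δ ^ 2 / (2 * (a + 1))) with hκ
  have hκ0 : 0 < κ := by positivity
  have hκ2 : a * (2 * κ) ≤ δ ^ 2 := by
    have h1 : κ ≤ δ ^ 2 / (2 * (a + 1)) := min_le_right _ _
    rw [le_div_iff₀ (by positivity)] at h1
    nlinarith
  have hlt : cost A B Binv gradF t p q < F t p - F t q + κ := by linarith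
  unfold cost at hlt
  obtain ⟨c, ⟨N, v, v', v'', hv, hv', hi1, hi2, hvv, h1, h2, h3, h4, rfl⟩, hclt⟩ :=
    exists_lt_of_csInf_lt (cost_set_nonempty A B Binv gradF t p q) hlt
  obtain ⟨z, hz, ⟨s, hs⟩, hS⟩ := approx_of_path hA1 hA2 hAsymm hBsymm hBpos hBinv₁ hBinv₂ hβ hβB
    hG hg hp hq hM hf hK hδ0 (min_le_left _ _) hκ2 (Nat.cast_nonneg N) hv hv'
    ((memLp_two_iff_integrable_sq_norm hi1.aestronglyMeasurable).2 hi2) hvv h1 h2 h3 h4 hclt.le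
  refine ⟨z, hz.mono (le_of_eq ?_), ⟨s, ?_⟩, hS⟩
  · rw [hδ]; field_simp
  · rw [hs, dist_self]; exact hε

lemma hanti_vf {A Ainv B : X →L[ℝ] X} (hAsymm : ∀ x y : X, ⟪A x, y⟫ = ⟪x, A y⟫)
    (hA2 : ∀ x, A (Ainv x) = x) (hBpos : ∀ x : X, 0 ≤ ⟪x, B x⟫) {G : X → ℝ} {g : X → X}
    (hG : ∀ x, HasGradientAt G (g x) x) {w : ℝ → X × X}
    (hw : ∀ s, HasDerivAt w (vf Ainv B g (w s)) s) : Antitone (fun s => En A G (w s)) := by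
  have h := En_deriv hAsymm hA2 hG hw
  refine antitone_of_deriv_nonpos (fun s => (h s).differentiableAt) fun s => ?_
  rw [(h s).deriv]
  have := hBpos (w s).2
  linarith

lemma hstrict_vf {A Ainv B : X →L[ℝ] X} (hAsymm : ∀ x y : X, ⟪A x, y⟫ = ⟪x, A y⟫)
    (hA2 : ∀ x, A (Ainv x) = x) (hBpos : ∀ x : X, x ≠ 0 → 0 < ⟪x, B x⟫) {G : X → ℝ} {g : X → X}
    (hG : ∀ x, HasGradientAt G (g x) x) {w : ℝ → X × X}
    (hw : ∀ s, HasDerivAt w (vf Ainv B g (w s)) s)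
    (hE : ∀ s, En A G (w s) = En A G (w 0)) : vf Ainv B g (w 0) = 0 := by
  have h := En_deriv hAsymm hA2 hG hw
  have hy : ∀ s, (w s).2 = 0 := by
    intro s
    have h1 : HasDerivAt (fun s => En A G (w s)) 0 s := by
      have : (fun s => En A G (w s)) = fun _ => En A G (w 0) := funext hE
      rw [this]; exact hasDerivAt_const _ _
    have h2 := (h s).unique h1
    by_contra hne
    have := hBpos _ hne
    linarith
  have h2 : HasDerivAt (fun s => (w s).2) (vf Ainv B g (w 0)).2 0 := (hw 0).snd
  have h3 : (fun s => (w s).2) = fun _ => (0 : X) := funext hy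
  rw [h3] at h2
  have h4 := h2.unique (hasDerivAt_const _ _)
  exact Prod.ext (hy 0) h4

lemma energy_bound {A : X →L[ℝ] X} {α : ℝ} (hα : 0 < α)
    (hαA : ∀ x : X, α * ‖x‖ ^ 2 ≤ ⟪x, A x⟫) {G : X → ℝ} {ρ c : ℝ}
    (hb : Bornology.IsBounded {x | G x ≤ ρ}) (hc : ∀ x, -c ≤ G x) :
    ∃ M, ∀ z : X × X, En A G z ≤ ρ → z ∈ Metric.closedBall (0 : X × X) M := by
  obtain ⟨R, hR⟩ := hb.exists_norm_le
  refine ⟨max R (2 * (ρ + c) / α + 1), fun z hz => ?_⟩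
  unfold En at hz
  have h1 := hαA z.2
  have h0 : 0 ≤ α * ‖z.2‖ ^ 2 := by positivity
  rw [mem_closedBall_zero_iff, Prod.norm_def]
  refine max_le_max (hR _ ?_) ?_
  · show G z.1 ≤ ρ
    linarith
  · have h2 := hc z.1
    have h3 : ‖z.2‖ ^ 2 ≤ 2 * (ρ + c) / α := by
      rw [le_div_iff₀ hα]; linarith
    nlinarith [sq_nonneg (‖z.2‖ - 1), norm_nonneg z.2]

lemma chain_convert {A Ainv B : X →L[ℝ] X} (hA2 : ∀ x, A (Ainv x) = x) {G : X → ℝ} {g : X → X}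
    {p q : X} (hp : g p = 0)
    (h : Relation.ReflTransGen (Het (vf Ainv B g) (En A G)) (p, 0) (q, 0)) :
    ∃ (m : ℕ) (w : ℕ → X) (V V' V'' : ℕ → ℝ → X),
      w 0 = p ∧ w m = q ∧
      (∀ i ≤ m, g (w i) = 0) ∧
      (∀ i ≤ m, ∀ j ≤ m, i ≠ j → w i ≠ w j) ∧
      (∀ i, 1 ≤ i → i ≤ m →
        (∀ s : ℝ, HasDerivAt (V i) (V' i s) s) ∧
        (∀ s : ℝ, HasDerivAt (V' i) (V'' i s) s) ∧
        (∀ s : ℝ, A (V'' i s) + B (V' i s) + g (V i s) = 0) ∧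
        Filter.Tendsto (V i) Filter.atBot (𝓝 (w (i - 1))) ∧
        Filter.Tendsto (V i) Filter.atTop (𝓝 (w i)) ∧
        Filter.Tendsto (V' i) Filter.atBot (𝓝 0) ∧
        Filter.Tendsto (V' i) Filter.atTop (𝓝 0)) := by
  obtain ⟨m, W, hW0, hWm, hW⟩ := chain_of_reflTransGen h
  have hz : ∀ i ≤ m, vf Ainv B g (W i) = 0 := by
    intro i hi
    rcases i with _ | i
    · rw [hW0, vf_eq_zero hA2]; exact ⟨rfl, hp⟩
    · exact (hW i hi).2.1
  have hz2 : ∀ i ≤ m, (W i).2 = 0 := fun i hi => ((vf_eq_zero hA2).1 (hz i hi)).1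
  have hdec : ∀ j, j ≤ m → ∀ i < j, En A G (W j) < En A G (W i) := by
    intro j
    induction j with
    | zero => intro _ i hi; omega
    | succ j ih =>
      intro hj i hi
      have h1 := (hW j hj).2.2.1
      rcases (Nat.lt_succ_iff.1 hi).lt_or_eq with h2 | rfl
      · exact h1.trans (ih (by omega) i h2)
      · exact h1
  have hch : ∀ i, ∃ ω : ℝ → X × X, i < m → (∀ s, HasDerivAt ω (vf Ainv B g (ω s)) s) ∧
      Tendsto ω atBot (𝓝 (W i)) ∧ Tendsto ω atTop (𝓝 (W (i + 1))) := by
    intro i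
    by_cases hi : i < m
    · obtain ⟨ω, hω⟩ := (hW i hi).2.2.2
      exact ⟨ω, fun _ => hω⟩
    · exact ⟨fun _ => 0, fun h => absurd h hi⟩
  choose ω hω using hch
  refine ⟨m, fun i => (W i).1, fun i s => (ω (i - 1) s).1, fun i s => (ω (i - 1) s).2,
    fun i s => -Ainv (B (ω (i - 1) s).2 + g (ω (i - 1) s).1), by simp [hW0], by simp [hWm],
    fun i hi => ((vf_eq_zero hA2).1 (hz i hi)).2, ?_, ?_⟩
  · intro i hi j hj hij heq
    have hWW : W i = W j := Prod.ext heq ((hz2 i hi).trans (hz2 j hj).symm)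
    rcases lt_or_gt_of_ne hij with h1 | h1
    · have := hdec j hj i h1
      rw [hWW] at this; exact lt_irrefl _ this
    · have := hdec i hi j h1
      rw [hWW] at this; exact lt_irrefl _ this
  · intro i hi him
    obtain ⟨k, rfl⟩ : ∃ k, i = k + 1 := ⟨i - 1, by omega⟩
    simp only [Nat.add_sub_cancel]
    obtain ⟨hd, hb, ht⟩ := hω k (by omega)
    refine ⟨fun s => (hd s).fst, fun s => (hd s).snd, fun s => ?_, ?_, ?_, ?_, ?_⟩
    · rw [map_neg, hA2]; abel
    · exact (continuous_fst.tendsto _).comp hb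
    · exact (continuous_fst.tendsto _).comp ht
    · have := (continuous_snd.tendsto _).comp hb
      rwa [hz2 k (by omega)] at this
    · have := (continuous_snd.tendsto _).comp ht
      rwa [hz2 (k + 1) him] at this

end Assembly

/-- If the energy drop between two critical points equals the cost, then they are connected by
a finite chain of heteroclinic solutions of the unscaled autonomous equation. -/
theorem heteroclinic_chain
    {X : Type*} [NormedAddCommGroup X] [InnerProductSpace ℝ X] [FiniteDimensional ℝ X]
    (A B Binv : X →L[ℝ] X)
    (hAsymm : ∀ x y : X, ⟪A x, y⟫ = ⟪x, A y⟫)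
    (hApos : ∀ x : X, x ≠ 0 → 0 < ⟪x, A x⟫)
    (hBsymm : ∀ x y : X, ⟪B x, y⟫ = ⟪x, B y⟫)
    (hBpos : ∀ x : X, x ≠ 0 → 0 < ⟪x, B x⟫)
    -- Binv is the inverse of B
    (hBinv₁ : ∀ x : X, Binv (B x) = x) (hBinv₂ : ∀ x : X, B (Binv x) = x)
    (T : ℝ) (hT : 0 < T)
    (F dtF : ℝ → X → ℝ) (gradF : ℝ → X → X)
    -- (F0)
    (hF0 : ContDiffOn ℝ 1 (fun p : ℝ × X => F p.1 p.2) (Set.Icc 0 T ×ˢ Set.univ))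
    (hgradF : ∀ t ∈ Set.Icc 0 T, ∀ x : X, HasGradientAt (F t) (gradF t x) x)
    (hdtF : ∀ x : X, ∀ t ∈ Set.Icc 0 T,
      HasDerivWithinAt (fun τ => F τ x) (dtF t x) (Set.Icc 0 T) t)
    -- (F1)
    (hF1 : ∀ ρ > (0 : ℝ), Bornology.IsBounded {x : X | ∀ t ∈ Set.Icc 0 T, |F t x| ≤ ρ})
    -- (F2)
    (C₁ C₂ : ℝ) (hC₁ : 0 < C₁) (hC₂ : 0 < C₂)
    (hF2 : ∀ t ∈ Set.Icc 0 T, ∀ x : X, |dtF t x| ≤ C₁ * F t x + C₂)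
    -- (F3)
    (dtgradF : ℝ → X → X)
    (hdtgradF : ∀ x : X, ∀ t ∈ Set.Icc 0 T,
      HasDerivWithinAt (fun τ => gradF τ x) (dtgradF t x) (Set.Icc 0 T) t)
    (hF3 : ∀ M > (0 : ℝ), ∃ a : ℝ → ℝ, MeasureTheory.IntegrableOn a (Set.Icc 0 T) ∧
      ∀ t ∈ Set.Icc 0 T, ∀ x : X, ‖x‖ ≤ M → ‖dtgradF t x‖ ≤ a t)
    -- (F4)
    (hessF : ℝ → X → X →L[ℝ] X)
    (hF4 : ∀ t ∈ Set.Icc 0 T, ContDiff ℝ 2 (F t))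
    (hhessF : ∀ t ∈ Set.Icc 0 T, ∀ x : X, HasFDerivAt (gradF t) (hessF t x) x)
    (hhessFc : ContinuousOn (fun p : ℝ × X => hessF p.1 p.2) (Set.Icc 0 T ×ˢ Set.univ))
    -- (F5)
    (hF5 : ∀ t ∈ Set.Icc 0 T, ∀ x : X, gradF t x = 0 →
      ∃ r > (0 : ℝ), ∀ y : X, gradF t y = 0 → y ∈ Metric.ball x r → y = x)
    (t : ℝ) (ht : t ∈ Set.Icc 0 T)
    (p q : X) (hp : gradF t p = 0) (hq : gradF t q = 0)
    (hbal : F t p - F t q = cost A B Binv gradF t p q) :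
    ∃ (m : ℕ) (w : ℕ → X) (V V' V'' : ℕ → ℝ → X),
      w 0 = p ∧ w m = q ∧
      -- the chain consists of distinct critical points of F(t,·)
      (∀ i ≤ m, gradF t (w i) = 0) ∧
      (∀ i ≤ m, ∀ j ≤ m, i ≠ j → w i ≠ w j) ∧
      -- heteroclinic connections
      (∀ i, 1 ≤ i → i ≤ m →
        (∀ s : ℝ, HasDerivAt (V i) (V' i s) s) ∧
        (∀ s : ℝ, HasDerivAt (V' i) (V'' i s) s) ∧
        (∀ s : ℝ, A (V'' i s) + B (V' i s) + gradF t (V i s) = 0) ∧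
        Filter.Tendsto (V i) Filter.atBot (𝓝 (w (i - 1))) ∧
        Filter.Tendsto (V i) Filter.atTop (𝓝 (w i)) ∧
        Filter.Tendsto (V' i) Filter.atBot (𝓝 0) ∧
        Filter.Tendsto (V' i) Filter.atTop (𝓝 0)) := by
  obtain ⟨Ainv, hA1, hA2⟩ := exists_inv A hApos
  obtain ⟨α, hα, hαA⟩ := posdef_coercive A hApos
  have hBinvpos : ∀ x : X, x ≠ 0 → 0 < ⟪x, Binv x⟫ := by
    intro x hx
    have hy : Binv x ≠ 0 := by
      intro h
      apply hx
      rw [← hBinv₂ x, h, map_zero]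
    have h1 := hBpos _ hy
    rwa [hBinv₂, real_inner_comm] at h1
  obtain ⟨β, hβ, hβB⟩ := posdef_coercive Binv hBinvpos
  have hBnn : ∀ x : X, 0 ≤ ⟪x, B x⟫ := by
    intro x
    by_cases hx : x = 0
    · simp [hx]
    · exact (hBpos x hx).le
  have hG := hgradF t ht
  have hgC : ContDiff ℝ 1 (gradF t) := by
    rw [contDiff_one_iff_fderiv]
    refine ⟨fun x => (hhessF t ht x).differentiableAt, ?_⟩
    have h1 : fderiv ℝ (gradF t) = fun x => hessF t x := funext fun x => (hhessF t ht x).fderiv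
    rw [h1]
    exact hhessFc.comp_continuous (f := fun x : X => (t, x)) (by fun_prop)
      (fun x => ⟨ht, mem_univ _⟩)
  have hlow : ∀ x, -(C₂ / C₁) ≤ F t x := by
    intro x
    have h1 := (abs_nonneg _).trans (hF2 t ht x)
    rw [← neg_div, div_le_iff₀ hC₁]
    linarith
  obtain ⟨M, hM⟩ := energy_bound hα hαA
    (sublevel_bounded hdtF hF1 hC₁ hC₂ hF2 ht (F t p + 1)) hlow
  have hvf := vf_contDiff Ainv B hgC
  obtain ⟨L, hL⟩ := LocallyLipschitzOn.exists_lipschitzOnWith_of_compact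
    (isCompact_closedBall (0 : X × X) M) hvf.locallyLipschitz.locallyLipschitzOn
  obtain ⟨K, hK⟩ := (isCompact_closedBall (0 : X × X) M).exists_bound_of_continuousOn
    hvf.continuous.continuousOn
  have happ := approached_of_cost hA1 hA2 hAsymm hBsymm hBnn hBinv₁ hBinv₂ hβ hβB hG
    hgC.continuous hp hq hM hL hK hbal
  have hFc : Continuous (F t) := continuous_iff_continuousAt.2 fun x => (hG x).continuousAt
  have hE : Continuous (En A (F t)) := by
    unfold En
    fun_prop
  refine chain_convert hA2 hp (chain hL hE
    (fun w hw => hanti_vf hAsymm hA2 hBnn hG hw.hasDerivAt)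
    (fun w hw hc => hstrict_vf hAsymm hA2 hBpos hG hw.hasDerivAt hc) ?_ ?_ ?_ happ)
  · intro z hz
    obtain ⟨hz2, hz1⟩ := (vf_eq_zero hA2).1 hz
    obtain ⟨r, hr, hrr⟩ := hF5 t ht z.1 hz1
    refine ⟨r, hr, fun y hy hyb => ?_⟩
    obtain ⟨hy2, hy1⟩ := (vf_eq_zero hA2).1 hy
    refine Prod.ext (hrr _ hy1 ?_) (hy2.trans hz2.symm)
    rw [Metric.mem_ball] at hyb ⊢
    exact lt_of_le_of_lt (by rw [Prod.dist_eq]; exact le_max_left _ _) hyb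
  · rw [vf_eq_zero hA2]; exact ⟨rfl, hp⟩
  · apply hM
    simp [En]
end

section
/- Let F : ℝ → ℝ be a C² function satisfying: F(0) = 0 and F(x) > 0 for x < 0; F(x) → +∞ as x → +∞; (H1) F'(x) = 0 if and only if x ∈ {0, 1, 2, 9}; (H2) F(1) = −1; (H3) F(2) = −1 + η for some 0 < η ≤ 1/10; (H4) F(3) = −3 and F'(x) ≤ −1 for every x ∈ [3,8]; (H5) F''(1) > 0 and F''(9) > 0. Let v₁ : ℝ → ℝ be a nonconstant C¹ solution of (1/4) v̇₁(s) = −F'(v₁(s)) with lim_{s→−∞} v₁(s) = 0, and let v₂ : ℝ → ℝ be a nonconstant C² solution of v̈₂(s) + (1/4) v̇₂(s) = −F'(v₂(s)) with lim_{s→−∞} v₂(s) = 0 and lim_{s→−∞} v̇₂(s) = 0. Then lim_{s→+∞} v₁(s) = 1 and lim_{s→+∞} v₂(s) = 9. -/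
open Set Filter Topology

lemma aux_barbalat (f f' f'' : ℝ → ℝ) (hf : ∀ s, HasDerivAt f (f' s) s)
    (hf' : ∀ s, HasDerivAt f' (f'' s) s) (C : ℝ) (hC : ∀ s, |f'' s| ≤ C) (L : ℝ)
    (hL : Tendsto f atTop (𝓝 L)) : Tendsto f' atTop (𝓝 0) := by
  have hC0 : 0 ≤ C := (abs_nonneg _).trans (hC 0)
  rw [Metric.tendsto_atTop]
  intro ε hε
  set h : ℝ := ε / (2 * (C + 1)) with hh
  have hpos : 0 < h := by positivity
  have hCh : C * h < ε / 2 := by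
    rw [hh, ← mul_div_assoc, div_lt_iff₀ (by positivity)]
    nlinarith
  have hsh : Tendsto (fun s : ℝ => s + h) atTop atTop := tendsto_atTop_add_const_right _ _ tendsto_id
  have h1 : Tendsto (fun s => f (s + h) - f s) atTop (𝓝 0) := by
    simpa using (hL.comp hsh).sub hL
  rw [Metric.tendsto_atTop] at h1
  obtain ⟨N, hN⟩ := h1 (h * (ε / 2)) (by positivity)
  refine ⟨N, fun s hs => ?_⟩
  have h2 := hN s hs
  simp only [Real.dist_eq, sub_zero] at h2 ⊢
  obtain ⟨c, hc, hce⟩ := exists_hasDerivAt_eq_slope f f' (show s < s + h by linarith)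
    (fun x _ => (hf x).continuousAt.continuousWithinAt) (fun x _ => hf x)
  obtain ⟨d, hd, hde⟩ := exists_hasDerivAt_eq_slope f' f'' hc.1
    (fun x _ => (hf' x).continuousAt.continuousWithinAt) (fun x _ => hf' x)
  have e1 : f' c * h = f (s + h) - f s := by
    rw [hce, add_sub_cancel_left]; field_simp
  have hcs : 0 < c - s := by linarith [hc.1]
  have e2 : f'' d * (c - s) = f' c - f' s := by
    rw [hde]; field_simp
  have b1 : |f' c| < ε / 2 := by
    rw [← e1, abs_mul, abs_of_pos hpos] at h2
    nlinarith
  have b2 : |f' c - f' s| < ε / 2 := by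
    rw [← e2, abs_mul, abs_of_pos hcs]
    have := hC d
    have := hc.2
    nlinarith [abs_nonneg (f'' d)]
  rw [abs_lt] at *
  constructor <;> linarith

lemma aux_gronwall (g g' : ℝ → ℝ) (hg : ∀ s, HasDerivAt g (g' s) s) (hg0 : ∀ s, 0 ≤ g s)
    (a b K : ℝ) (hK : ∀ s ∈ Icc a b, |g' s| ≤ K * g s) (s₀ : ℝ) (hs₀ : s₀ ∈ Icc a b)
    (h0 : g s₀ = 0) (s : ℝ) (hs : s ∈ Icc a b) : g s = 0 := by
  have hd : ∀ (k x : ℝ), HasDerivAt (fun s => Real.exp (k * s) * g s)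
      (Real.exp (k * x) * (k * g x + g' x)) x := by
    intro k x
    have h1 : HasDerivAt (fun s : ℝ => Real.exp (k * s)) (Real.exp (k * x) * (k * 1)) x :=
      ((hasDerivAt_id x).const_mul k).exp
    exact (h1.fun_mul (hg x)).congr_deriv (by ring)
  apply le_antisymm _ (hg0 s)
  rcases le_total s₀ s with h | h
  · have : AntitoneOn (fun s => Real.exp ((-K) * s) * g s) (Icc a b) := by
      apply antitoneOn_of_hasDerivWithinAt_nonpos (convex_Icc a b)
        (fun x _ => (hd (-K) x).continuousAt.continuousWithinAt)
        (fun x _ => (hd (-K) x).hasDerivWithinAt)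
      intro x hx
      have := hK x (interior_subset hx)
      rw [abs_le] at this
      have e := Real.exp_pos ((-K) * x)
      apply mul_nonpos_of_nonneg_of_nonpos e.le
      linarith
    have := this hs₀ hs h
    simp only [h0, mul_zero] at this
    by_contra hc
    push Not at hc
    have := mul_pos (Real.exp_pos ((-K) * s)) hc
    linarith
  · have : MonotoneOn (fun s => Real.exp (K * s) * g s) (Icc a b) := by
      apply monotoneOn_of_hasDerivWithinAt_nonneg (convex_Icc a b)
        (fun x _ => (hd K x).continuousAt.continuousWithinAt)
        (fun x _ => (hd K x).hasDerivWithinAt)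
      intro x hx
      have := hK x (interior_subset hx)
      rw [abs_le] at this
      apply mul_nonneg (Real.exp_pos (K * x)).le
      linarith
    have := this hs hs₀ h
    simp only [h0, mul_zero] at this
    by_contra hc
    push Not at hc
    have := mul_pos (Real.exp_pos (K * s)) hc
    linarith

lemma aux_lip (D D2 : ℝ → ℝ) (hD : ∀ x, HasDerivAt D (D2 x) x) (hD2 : Continuous D2)
    (c : ℝ) (hc : D c = 0) (M : ℝ) : ∃ K : ℝ, 0 ≤ K ∧ ∀ x, |x - c| ≤ M → |D x| ≤ K * |x - c| := by
  obtain ⟨K, hK⟩ := (isCompact_closedBall c M).exists_bound_of_continuousOn hD2.continuousOn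
  refine ⟨|K|, abs_nonneg _, fun x hx => ?_⟩
  have hM : 0 ≤ M := (abs_nonneg _).trans hx
  have := (convex_closedBall c M).norm_image_sub_le_of_norm_hasDerivWithin_le
    (fun y _ => (hD y).hasDerivWithinAt) (fun y hy => (hK y hy).trans (le_abs_self K))
    (Metric.mem_closedBall_self hM) (show x ∈ Metric.closedBall c M by
      simpa [Real.dist_eq] using hx)
  simpa [hc] using this

lemma aux_bdd (v : ℝ → ℝ) (hv : Continuous v) (a b : ℝ) : ∃ M, ∀ s ∈ Icc a b, |v s| ≤ M :=
  isCompact_Icc.exists_bound_of_continuousOn hv.continuousOn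

/-- uniqueness for the first order equation -/
lemma aux_uniq1 (D D2 : ℝ → ℝ) (hD : ∀ x, HasDerivAt D (D2 x) x) (hD2 : Continuous D2)
    (c : ℝ) (hc : D c = 0) (v v' : ℝ → ℝ) (hv : ∀ s, HasDerivAt v (v' s) s)
    (heq : ∀ s, (1 / 4) * v' s = - D (v s)) (s₀ : ℝ) (h0 : v s₀ = c) (s : ℝ) : v s = c := by
  have hvc : Continuous v := continuous_iff_continuousAt.2 fun s => (hv s).continuousAt
  obtain ⟨M, hM⟩ := aux_bdd (fun s => v s - c) (by fun_prop) (min s₀ s) (max s₀ s)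
  obtain ⟨K, hK0, hK⟩ := aux_lip D D2 hD hD2 c hc M
  have hg : ∀ s, HasDerivAt (fun s => (v s - c) ^ 2) (2 * (v s - c) * v' s) s := by
    intro s
    exact (((hv s).sub_const c).fun_pow 2).congr_deriv (by norm_num)
  have := aux_gronwall _ _ hg (fun s => sq_nonneg _) (min s₀ s) (max s₀ s) (8 * K) (by
    intro t ht
    have h1 := hK (v t) (hM t ht)
    have h2 : v' t = - 4 * D (v t) := by linarith [heq t]
    rw [h2, abs_mul, abs_mul, abs_mul, ← sq_abs (v t - c), abs_two, abs_neg,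
      abs_of_pos (by norm_num : (0:ℝ) < 4)]
    nlinarith [mul_le_mul_of_nonneg_left h1 (abs_nonneg (v t - c))]) s₀ ⟨min_le_left _ _, le_max_left _ _⟩ (by simp [h0]) s
    ⟨min_le_right _ _, le_max_right _ _⟩
  have := pow_eq_zero_iff (two_ne_zero) |>.1 this
  linarith

/-- uniqueness for the second order equation -/
lemma aux_uniq2 (D D2 : ℝ → ℝ) (hD : ∀ x, HasDerivAt D (D2 x) x) (hD2 : Continuous D2)
    (c : ℝ) (hc : D c = 0) (v v' v'' : ℝ → ℝ) (hv : ∀ s, HasDerivAt v (v' s) s)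
    (hv' : ∀ s, HasDerivAt v' (v'' s) s)
    (heq : ∀ s, v'' s + (1 / 4) * v' s = - D (v s)) (s₀ : ℝ) (h0 : v s₀ = c) (h0' : v' s₀ = 0)
    (s : ℝ) : v s = c := by
  have hvc : Continuous v := continuous_iff_continuousAt.2 fun s => (hv s).continuousAt
  obtain ⟨M, hM⟩ := aux_bdd (fun s => v s - c) (by fun_prop) (min s₀ s) (max s₀ s)
  obtain ⟨K, hK0, hK⟩ := aux_lip D D2 hD hD2 c hc M
  have hg : ∀ s, HasDerivAt (fun s => (v s - c) ^ 2 + v' s ^ 2)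
      (2 * (v s - c) * v' s + 2 * v' s * v'' s) s := by
    intro s
    exact ((((hv s).sub_const c).fun_pow 2).fun_add ((hv' s).fun_pow 2)).congr_deriv (by norm_num)
  have := aux_gronwall _ _ hg (fun s => by positivity) (min s₀ s) (max s₀ s) (2 + K) (by
    intro t ht
    have h1 := hK (v t) (hM t ht)
    have h2 : v'' t = - D (v t) - (1 / 4) * v' t := by linarith [heq t]
    rw [h2]
    have e1 : |(v t - c) * v' t| ≤ ((v t - c) ^ 2 + v' t ^ 2) / 2 := by
      rw [abs_le]; constructor <;> nlinarith [sq_nonneg (v t - c - v' t), sq_nonneg (v t - c + v' t)]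
    have e2 : |D (v t) * v' t| ≤ K * (((v t - c) ^ 2 + v' t ^ 2) / 2) := by
      refine le_trans ?_ (mul_le_mul_of_nonneg_left e1 hK0)
      rw [abs_mul, abs_mul, ← mul_assoc]
      exact mul_le_mul_of_nonneg_right h1 (abs_nonneg _)
    rw [abs_le] at *
    constructor <;> nlinarith [sq_nonneg (v t - c), sq_nonneg (v' t)]) s₀
    ⟨min_le_left _ _, le_max_left _ _⟩ (by simp [h0, h0']) s
    ⟨min_le_right _ _, le_max_right _ _⟩
  have h3 : (v s - c) ^ 2 = 0 := by nlinarith [sq_nonneg (v s - c), sq_nonneg (v' s)]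
  have := pow_eq_zero_iff (two_ne_zero) |>.1 h3
  linarith

lemma aux_sign (D : ℝ → ℝ) (hD : Continuous D) (a b c x : ℝ) (hne : ∀ y ∈ Ioo a b, D y ≠ 0)
    (hc : c ∈ Ioo a b) (hcn : D c < 0) (hx : x ∈ Ioo a b) : D x < 0 := by
  by_contra h
  push Not at h
  have := (isPreconnected_Ioo (a := a) (b := b)).intermediate_value hc hx hD.continuousOn
    (show (0:ℝ) ∈ Icc (D c) (D x) from ⟨hcn.le, h⟩)
  obtain ⟨y, hy, hy0⟩ := this
  exact hne y hy hy0

lemma aux_part1 (F D D2 : ℝ → ℝ) (hFD : ∀ x, HasDerivAt F (D x) x)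
    (hDD : ∀ x, HasDerivAt D (D2 x) x) (hD2 : Continuous D2)
    (hF0 : F 0 = 0) (hFneg : ∀ x < (0 : ℝ), 0 < F x)
    (hD0 : D 0 = 0) (hD1 : D 1 = 0) (neg01 : ∀ x ∈ Ioo (0:ℝ) 1, D x < 0)
    (v v' : ℝ → ℝ) (hv : ∀ s : ℝ, HasDerivAt v (v' s) s)
    (heq : ∀ s : ℝ, (1 / 4) * v' s = - D (v s))
    (hnc : ∃ s₁ s₂ : ℝ, v s₁ ≠ v s₂)
    (hlim : Tendsto v atBot (𝓝 0)) : Tendsto v atTop (𝓝 1) := by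
  have hvc : Continuous v := continuous_iff_continuousAt.2 fun s => (hv s).continuousAt
  have hDc : Continuous D := continuous_iff_continuousAt.2 fun s => (hDD s).continuousAt
  have heq' : ∀ s, v' s = -4 * D (v s) := fun s => by linarith [heq s]
  have hanti : Antitone (fun s => F (v s)) := by
    apply antitone_of_hasDerivAt_nonpos (fun s => (hFD (v s)).comp s (hv s))
    intro s
    simp only [Pi.zero_apply, heq']
    nlinarith [sq_nonneg (D (v s))]
  have hFlim : Tendsto (fun s => F (v s)) atBot (𝓝 0) := by
    have := (hFD 0).continuousAt.tendsto.comp hlim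
    rwa [hF0] at this
  have hFle : ∀ s, F (v s) ≤ 0 := fun s => hanti.ge_of_tendsto hFlim s
  have hnn : ∀ s, 0 ≤ v s := by
    intro s
    by_contra h
    push Not at h
    linarith [hFneg _ h, hFle s]
  have hne : ∀ c, D c = 0 → ∀ s, v s ≠ c := by
    intro c hc s hs
    obtain ⟨a, b, hab⟩ := hnc
    apply hab
    rw [aux_uniq1 D D2 hDD hD2 c hc v v' hv heq s hs a,
      aux_uniq1 D D2 hDD hD2 c hc v v' hv heq s hs b]
  have hpos : ∀ s, 0 < v s := fun s => lt_of_le_of_ne (hnn s) (hne 0 hD0 s).symm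
  have hlt : ∀ s, v s < 1 := by
    intro s
    by_contra h
    push Not at h
    obtain ⟨a, ha⟩ := (hlim.eventually (gt_mem_nhds (show (0:ℝ) < 1 by norm_num))).exists
    obtain ⟨t, ht⟩ := mem_range_of_exists_le_of_exists_ge hvc ⟨a, ha.le⟩ ⟨s, h⟩
    exact hne 1 hD1 t ht
  have hv'pos : ∀ s, 0 < v' s := by
    intro s
    rw [heq']
    linarith [neg01 (v s) ⟨hpos s, hlt s⟩]
  have hmono : Monotone v := monotone_of_hasDerivAt_nonneg hv (fun s => (hv'pos s).le)
  obtain ⟨L, hL⟩ : ∃ L, Tendsto v atTop (𝓝 L) :=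
    ⟨_, tendsto_atTop_ciSup hmono ⟨1, by rintro _ ⟨s, rfl⟩; exact (hlt s).le⟩⟩
  have hv'' : ∀ s, HasDerivAt v' (-4 * (D2 (v s) * v' s)) s := by
    intro s
    have : v' = fun s => -4 * D (v s) := funext heq'
    have h2 := ((hDD (v s)).comp s (hv s)).const_mul (-4)
    rw [this]
    rw [this] at h2
    exact h2
  obtain ⟨A, hA⟩ := isCompact_Icc.exists_bound_of_continuousOn (hD2.continuousOn (s := Icc 0 1))
  obtain ⟨B, hB⟩ := isCompact_Icc.exists_bound_of_continuousOn (hDc.continuousOn (s := Icc 0 1))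
  have h0 := aux_barbalat v v' _ hv hv'' (4 * (A * (4 * B))) (by
    intro s
    have hm : v s ∈ Icc (0:ℝ) 1 := ⟨hnn s, (hlt s).le⟩
    have a1 := hA _ hm
    have a2 := hB _ hm
    rw [Real.norm_eq_abs] at a1 a2
    rw [heq', abs_mul, abs_mul, abs_mul, abs_neg, abs_of_pos (by norm_num : (0:ℝ) < 4)]
    have : 0 ≤ A := (abs_nonneg _).trans a1
    gcongr) L hL
  have h1 : Tendsto v' atTop (𝓝 (-4 * D L)) := by
    have : v' = fun s => -4 * D (v s) := funext heq'
    rw [this]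
    exact ((hDc.tendsto L).comp hL).const_mul (-4)
  have hDL : D L = 0 := by
    have := tendsto_nhds_unique h0 h1
    linarith
  have hL1 : L ≤ 1 := le_of_tendsto' hL fun s => (hlt s).le
  have hL0 : 0 < L := (hpos 0).trans_le (hmono.ge_of_tendsto hL 0)
  rcases hL1.lt_or_eq with h | h
  · linarith [neg01 L ⟨hL0, h⟩]
  · rwa [h] at hL

lemma aux_part2 (F D D2 : ℝ → ℝ) (hFD : ∀ x, HasDerivAt F (D x) x)
    (hDD : ∀ x, HasDerivAt D (D2 x) x) (hD2 : Continuous D2)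
    (hF0 : F 0 = 0) (hFneg : ∀ x < (0 : ℝ), 0 < F x)
    (hFcoer : Tendsto F atTop atTop)
    (hH1 : ∀ x : ℝ, D x = 0 ↔ x ∈ ({0, 1, 2, 9} : Set ℝ))
    (neg01 : ∀ x ∈ Ioo (0:ℝ) 1, D x < 0) (neg29 : ∀ x ∈ Ioo (2:ℝ) 9, D x < 0)
    (hlow : ∀ x ∈ Icc (0:ℝ) 2, -1 ≤ F x) (hup : ∀ x ∈ Icc (1:ℝ) 2, F x ≤ -(9/10))
    (hF3 : F 3 = -3)
    (v v' v'' : ℝ → ℝ) (hv : ∀ s : ℝ, HasDerivAt v (v' s) s)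
    (hv' : ∀ s : ℝ, HasDerivAt v' (v'' s) s)
    (heq : ∀ s : ℝ, v'' s + (1 / 4) * v' s = - D (v s))
    (hnc : ∃ s₁ s₂ : ℝ, v s₁ ≠ v s₂)
    (hlim : Tendsto v atBot (𝓝 0)) (hlim' : Tendsto v' atBot (𝓝 0)) :
    Tendsto v atTop (𝓝 9) := by
  have hvc : Continuous v := continuous_iff_continuousAt.2 fun s => (hv s).continuousAt
  have hv'c : Continuous v' := continuous_iff_continuousAt.2 fun s => (hv' s).continuousAt
  have hDc : Continuous D := continuous_iff_continuousAt.2 fun s => (hDD s).continuousAt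
  have hFc : Continuous F := continuous_iff_continuousAt.2 fun s => (hFD s).continuousAt
  have heq' : ∀ s, v'' s = - D (v s) - (1/4) * v' s := fun s => by linarith [heq s]
  have hD0 : D 0 = 0 := (hH1 0).2 (by simp)
  obtain ⟨E, hEdef⟩ : ∃ E : ℝ → ℝ, ∀ s, E s = v' s ^ 2 / 2 + F (v s) := ⟨_, fun _ => rfl⟩
  have hEfun : E = fun s => v' s ^ 2 / 2 + F (v s) := funext hEdef
  have hE : ∀ s, HasDerivAt E (-(v' s ^ 2 / 4)) s := by
    intro s
    rw [hEfun]
    refine ((((hv' s).fun_pow 2).div_const 2).fun_add ((hFD (v s)).comp s (hv s))).congr_deriv ?_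
    rw [heq']
    norm_num
    ring
  have hEanti : Antitone E := by
    apply antitone_of_hasDerivAt_nonpos hE
    intro s
    simp only [Pi.zero_apply]
    nlinarith [sq_nonneg (v' s)]
  have hElim : Tendsto E atBot (𝓝 0) := by
    rw [hEfun]
    have h1 := (hlim'.pow 2).div_const 2
    have h2 := (hFc.tendsto 0).comp hlim
    have := h1.add h2
    simpa [hF0] using this
  have hE0 : ∀ s, E s ≤ 0 := fun s => hEanti.ge_of_tendsto hElim s
  have hFE : ∀ s, F (v s) ≤ E s := fun s => by
    rw [hEdef]; nlinarith [sq_nonneg (v' s)]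
  have hnn : ∀ s, 0 ≤ v s := by
    intro s
    by_contra h
    push Not at h
    linarith [hFneg _ h, hFE s, hE0 s]
  -- strict negativity of the energy
  have hEneg : ∀ s, E s < 0 := by
    intro s
    refine lt_of_le_of_ne (hE0 s) fun hs => ?_
    have hEz : ∀ t ≤ s, E t = 0 := fun t ht => le_antisymm (hE0 t) (hs ▸ hEanti ht)
    have hv'z : ∀ t < s, v' t = 0 := by
      intro t ht
      have h1 : HasDerivAt E 0 t := by
        apply (hasDerivAt_const t (0:ℝ)).congr_of_eventuallyEq
        filter_upwards [Iio_mem_nhds ht] with x hx using hEz x (le_of_lt hx)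
      have h2 := (hE t).unique h1
      have h3 : v' t ^ 2 = 0 := by linarith
      exact pow_eq_zero_iff two_ne_zero |>.1 h3
    have hvz : ∀ t < s, v t = 0 := by
      intro t ht
      have hconst : ∀ r < t, v r = v t := by
        intro r hr
        obtain ⟨c, hc, hce⟩ := exists_hasDerivAt_eq_slope v v' hr hvc.continuousOn
          (fun x _ => hv x)
        rw [hv'z c (hc.2.trans ht), eq_comm, div_eq_zero_iff] at hce
        rcases hce with h | h <;> linarith
      have : Tendsto v atBot (𝓝 (v t)) := by
        apply tendsto_const_nhds.congr'
        filter_upwards [eventually_lt_atBot t] with r hr using (hconst r hr).symm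
      exact tendsto_nhds_unique this hlim
    obtain ⟨a, b, hab⟩ := hnc
    apply hab
    have h1 : s - 1 < s := by linarith
    have hu := aux_uniq2 D D2 hDD hD2 0 hD0 v v' v'' hv hv' heq (s-1) (hvz _ h1) (hv'z _ h1)
    rw [hu a, hu b]
  have hpos : ∀ s, 0 < v s := by
    intro s
    refine lt_of_le_of_ne (hnn s) fun h => ?_
    have := hFE s
    rw [← h, hF0] at this
    linarith [hEneg s]
  -- boundedness
  obtain ⟨M, hM⟩ : ∃ M, ∀ s, v s ≤ M := by
    obtain ⟨M, hM⟩ := (hFcoer.eventually_gt_atTop 0).exists_forall_of_atTop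
    refine ⟨M, fun s => ?_⟩
    by_contra h
    push Not at h
    linarith [hM (v s) h.le, hFE s, hE0 s]
  have hmem : ∀ s, v s ∈ Icc 0 M := fun s => ⟨hnn s, hM s⟩
  obtain ⟨A, hA⟩ := isCompact_Icc.exists_bound_of_continuousOn (hFc.continuousOn (s := Icc 0 M))
  obtain ⟨B, hB⟩ := isCompact_Icc.exists_bound_of_continuousOn (hDc.continuousOn (s := Icc 0 M))
  obtain ⟨C, hC⟩ := isCompact_Icc.exists_bound_of_continuousOn (hD2.continuousOn (s := Icc 0 M))
  have hA' : ∀ s, |F (v s)| ≤ A := fun s => hA _ (hmem s)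
  have hB' : ∀ s, |D (v s)| ≤ B := fun s => hB _ (hmem s)
  have hC' : ∀ s, |D2 (v s)| ≤ C := fun s => hC _ (hmem s)
  have hA0 : 0 ≤ A := (abs_nonneg _).trans (hA' 0)
  have hB0 : 0 ≤ B := (abs_nonneg _).trans (hB' 0)
  have hC0 : 0 ≤ C := (abs_nonneg _).trans (hC' 0)
  have hP : ∀ s, |v' s| ≤ A + 1 := by
    intro s
    have h1 := hE0 s
    rw [hEdef] at h1
    have h2 := neg_abs_le (F (v s))
    have h3 := hA' s
    apply abs_le_of_sq_le_sq _ (by linarith)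
    nlinarith
  have hQ : ∀ s, |v'' s| ≤ B + (A + 1) := by
    intro s
    rw [heq']
    have h1 := hB' s
    have h2 := hP s
    rw [abs_le] at *
    constructor <;> linarith
  obtain ⟨e, he⟩ : ∃ e, Tendsto E atTop (𝓝 e) := by
    refine ⟨_, tendsto_atTop_ciInf hEanti ⟨-A, ?_⟩⟩
    rintro _ ⟨s, rfl⟩
    have h2 := neg_abs_le (F (v s))
    linarith [hFE s, hA' s]
  have hv'0 : Tendsto v' atTop (𝓝 0) := by
    have h1 := aux_barbalat E _ (fun s => -(v' s * v'' s / 2)) hE (by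
      intro s
      exact (((hv' s).fun_pow 2).div_const 4).fun_neg.congr_deriv (by norm_num; ring))
      ((A + 1) * (B + (A + 1)) / 2) (by
        intro s
        rw [abs_neg, abs_div, abs_mul, abs_two]
        have := hP s
        have := hQ s
        gcongr) e he
    have h2 : Tendsto (fun s => v' s ^ 2) atTop (𝓝 0) := by
      have := h1.const_mul (-4)
      rw [mul_zero] at this
      refine this.congr fun s => by ring
    have h3 := h2.sqrt
    simp only [Real.sqrt_sq_eq_abs, Real.sqrt_zero] at h3
    exact (tendsto_zero_iff_abs_tendsto_zero _).2 h3
  have hv''0 : Tendsto v'' atTop (𝓝 0) := by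
    refine aux_barbalat v' v'' (fun s => - (D2 (v s) * v' s) - (1/4) * v'' s) hv' (by
      intro s
      have h1 := (((hDD (v s)).comp s (hv s)).fun_neg).fun_sub ((hv' s).const_mul (1/4))
      refine h1.congr_of_eventuallyEq (Eventually.of_forall fun t => ?_)
      simpa using heq' t) (C * (A + 1) + (B + (A + 1))) (by
        intro s
        have h1 := hQ s
        have h2 : |D2 (v s) * v' s| ≤ C * (A + 1) := by
          rw [abs_mul]
          have := hP s
          have := hC' s
          gcongr
        rw [abs_le] at *
        constructor <;> linarith) 0 hv'0
  have hDv : Tendsto (fun s => D (v s)) atTop (𝓝 0) := by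
    have h1 := (hv''0.add (hv'0.const_mul (1/4))).neg
    simp only [mul_zero, add_zero, neg_zero] at h1
    refine h1.congr fun s => ?_
    rw [heq s, neg_neg]
  -- energy control on an initial monotone phase
  have hmonoT : ∀ T, (∀ s < T, 0 < v' s) → MonotoneOn v (Iic T) := by
    intro T hT
    apply monotoneOn_of_hasDerivWithinAt_nonneg (convex_Iic T) hvc.continuousOn
      (fun x _ => (hv x).hasDerivWithinAt)
    intro x hx
    rw [interior_Iic] at hx
    exact (hT x hx).le
  have hkey : ∀ T, (∀ s < T, 0 < v' s) → v T ≤ 2 → -(18/25) ≤ E T := by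
    intro T hT hvT
    have hG : MonotoneOn (fun s => E s + 9/25 * v s) (Iic T) := by
      apply monotoneOn_of_hasDerivWithinAt_nonneg (convex_Iic T)
        (fun x _ => ((hE x).fun_add ((hv x).const_mul (9/25))).continuousAt.continuousWithinAt)
        (fun x _ => ((hE x).fun_add ((hv x).const_mul (9/25))).hasDerivWithinAt)
      intro x hx
      rw [interior_Iic] at hx
      have h1 := hT x hx
      have h2 : v x ≤ 2 := by
        have hx' : x ≤ T := le_of_lt hx
        exact (hmonoT T hT hx' (le_refl T) hx').trans hvT
      have h3 := hlow (v x) ⟨hnn x, h2⟩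
      have h4 := hE0 x
      rw [hEdef] at h4
      have h5 : v' x ≤ 36/25 := by nlinarith
      nlinarith
    have hGl : Tendsto (fun s => E s + 9/25 * v s) atBot (𝓝 0) := by
      simpa using hElim.add (hlim.const_mul (9/25))
    have : 0 ≤ E T + 9/25 * v T := by
      apply le_of_tendsto hGl
      filter_upwards [eventually_le_atBot T] with s hs
      exact hG hs (le_refl T) hs
    linarith
  -- initial phase
  obtain ⟨S, hS⟩ : ∃ S, ∀ s ≤ S, 0 < v' s := by
    obtain ⟨S, hS⟩ := (hlim.eventually (gt_mem_nhds (show (0:ℝ) < 1 by norm_num))).exists_forall_of_atBot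
    refine ⟨S, ?_⟩
    have hd : ∀ x, HasDerivAt (fun s => Real.exp (1/4 * s) * v' s)
        (Real.exp (1/4 * x) * (- D (v x))) x := by
      intro x
      have h1 : HasDerivAt (fun s : ℝ => Real.exp (1/4 * s)) (Real.exp (1/4 * x) * (1/4 * 1)) x :=
        ((hasDerivAt_id x).const_mul (1/4)).exp
      exact (h1.fun_mul (hv' x)).congr_deriv (by rw [heq' x]; ring)
    have hmo : StrictMonoOn (fun s => Real.exp (1/4 * s) * v' s) (Iic S) := by
      apply strictMonoOn_of_hasDerivWithinAt_pos (convex_Iic S)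
        (fun x _ => (hd x).continuousAt.continuousWithinAt)
        (fun x _ => (hd x).hasDerivWithinAt)
      intro x hx
      apply mul_pos (Real.exp_pos _)
      have hx' : x ∈ Iic S := interior_subset hx
      linarith [neg01 (v x) ⟨hpos x, hS x hx'⟩]
    have hl : Tendsto (fun s => Real.exp (1/4 * s) * v' s) atBot (𝓝 0) := by
      have h1 : Tendsto (fun s : ℝ => Real.exp (1/4 * s)) atBot (𝓝 0) :=
        Real.tendsto_exp_atBot.comp (tendsto_id.const_mul_atBot (by norm_num))
      simpa using h1.mul hlim'
    intro s hs
    have h1 : 0 ≤ Real.exp (1/4 * (s-1)) * v' (s-1) := by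
      apply le_of_tendsto hl
      filter_upwards [eventually_le_atBot (s-1)] with r hr
      exact hmo.monotoneOn (show r ≤ S by linarith) (show s - 1 ≤ S by linarith) hr
    have h2 : Real.exp (1/4 * (s-1)) * v' (s-1) < Real.exp (1/4 * s) * v' s :=
      hmo (show s - 1 ≤ S by linarith) hs (show s - 1 < s by linarith)
    exact pos_of_mul_pos_right (h1.trans_lt h2) (Real.exp_pos _).le
  by_cases hall : ∀ s, 0 < v' s
  · -- monotone case
    have hmono : Monotone v := monotone_of_hasDerivAt_nonneg hv (fun s => (hall s).le)
    obtain ⟨L, hL⟩ : ∃ L, Tendsto v atTop (𝓝 L) :=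
      ⟨_, tendsto_atTop_ciSup hmono ⟨M, by rintro _ ⟨s, rfl⟩; exact hM s⟩⟩
    have hDL : D L = 0 := tendsto_nhds_unique ((hDc.tendsto L).comp hL) hDv
    have hL0 : 0 < L := (hpos 0).trans_le (hmono.ge_of_tendsto hL 0)
    have hbad : L ∈ Icc (1:ℝ) 2 → False := by
      intro hLm
      have h1 : Tendsto E atTop (𝓝 (F L)) := by
        rw [hEfun]
        simpa using ((hv'0.pow 2).div_const 2).add ((hFc.tendsto L).comp hL)
      have h2 : -(18/25) ≤ F L := ge_of_tendsto' h1 fun s =>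
        hkey s (fun t _ => hall t) ((hmono.ge_of_tendsto hL s).trans hLm.2)
      linarith [hup L hLm]
    have := (hH1 L).1 hDL
    simp only [mem_insert_iff, mem_singleton_iff] at this
    rcases this with h | h | h | h
    · linarith
    · exact (hbad ⟨by linarith, by linarith⟩).elim
    · exact (hbad ⟨by linarith, by linarith⟩).elim
    · rwa [h] at hL
  · push Not at hall
    obtain ⟨s₁, hs₁⟩ := hall
    -- first time where the velocity vanishes
    obtain ⟨T, hT0, hT⟩ : ∃ T, v' T ≤ 0 ∧ ∀ s < T, 0 < v' s := by
      have hne : {s | v' s ≤ 0}.Nonempty := ⟨s₁, hs₁⟩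
      have hbb : BddBelow {s | v' s ≤ 0} := by
        refine ⟨S, fun s hs => ?_⟩
        by_contra h
        push Not at h
        have := hS s h.le
        have h2 : v' s ≤ 0 := hs
        linarith
      have hcl : IsClosed {s | v' s ≤ 0} := isClosed_le hv'c continuous_const
      refine ⟨_, hcl.csInf_mem hne hbb, fun s hs => ?_⟩
      by_contra h
      push Not at h
      exact absurd (csInf_le hbb h) (not_le.2 hs)
    have hT1 : v' T = 0 := by
      apply le_antisymm hT0
      have : Tendsto v' (𝓝[<] T) (𝓝 (v' T)) := (hv'c.tendsto T).mono_left nhdsWithin_le_nhds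
      apply ge_of_tendsto this
      filter_upwards [self_mem_nhdsWithin] with s hs using (hT s hs).le
    have hT2 : v'' T ≤ 0 := by
      have h1 := (hv' T).tendsto_slope.mono_left (nhdsLT_le_nhdsNE T)
      apply le_of_tendsto h1
      filter_upwards [self_mem_nhdsWithin] with s hs
      rw [slope_def_field, hT1]
      have h2 := hT s hs
      have h3 : s - T < 0 := sub_neg.2 hs
      have h4 : T - s > 0 := by linarith
      first
        | exact div_nonpos_of_nonneg_of_nonpos (by linarith) h3.le
        | exact div_nonpos_of_nonpos_of_nonneg (by linarith) h4.le
    have hDT : 0 ≤ D (v T) := by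
      have := heq T
      rw [hT1] at this
      linarith
    have hT9 : 9 ≤ v T := by
      by_contra h
      push Not at h
      have h1 : 1 ≤ v T := by
        by_contra h'
        push Not at h'
        linarith [neg01 _ ⟨hpos T, h'⟩]
      have h2 : v T ≤ 2 := by
        by_contra h'
        push Not at h'
        linarith [neg29 _ ⟨h', h⟩]
      have h3 := hkey T hT h2
      rw [hEdef, hT1] at h3
      linarith [hup _ ⟨h1, h2⟩]
    -- the energy drops below -1
    obtain ⟨s₂, hs₂⟩ : ∃ s, E s < -1 := by
      by_contra hcon
      push Not at hcon
      obtain ⟨a, ha3, haT⟩ : ∃ a, v a < 3 ∧ a ≤ T :=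
        ((hlim.eventually (gt_mem_nhds (show (0:ℝ) < 3 by norm_num))).and
          (eventually_le_atBot T)).exists
      obtain ⟨b, hb, hb3⟩ := intermediate_value_Icc haT hvc.continuousOn
        (show (3:ℝ) ∈ Icc (v a) (v T) from ⟨ha3.le, by linarith⟩)
      obtain ⟨c, hc, hc8⟩ := intermediate_value_Icc hb.2 hvc.continuousOn
        (show (8:ℝ) ∈ Icc (v b) (v T) from ⟨by linarith, by linarith⟩)
      have hG : AntitoneOn (fun s => E s + 1/2 * v s) (Icc b c) := by
        apply antitoneOn_of_hasDerivWithinAt_nonpos (convex_Icc b c)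
          (fun x _ => ((hE x).fun_add ((hv x).const_mul (1/2))).continuousAt.continuousWithinAt)
          (fun x _ => ((hE x).fun_add ((hv x).const_mul (1/2))).hasDerivWithinAt)
        intro x hx
        rw [interior_Icc] at hx
        have hxT : x < T := hx.2.trans_le hc.2
        have h1 := hT x hxT
        have h2 : v b ≤ v x := hmonoT T hT hb.2 hxT.le hx.1.le
        have h3 : v x ≤ v c := hmonoT T hT hxT.le hc.2 hx.2.le
        have h4 : F (v x) ≤ F 3 := by
          have hanti : AntitoneOn F (Icc 2 9) := by
            apply antitoneOn_of_hasDerivWithinAt_nonpos (convex_Icc 2 9) hFc.continuousOn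
              (fun x _ => (hFD x).hasDerivWithinAt)
            intro y hy
            rw [interior_Icc] at hy
            exact (neg29 y hy).le
          exact hanti ⟨by norm_num, by norm_num⟩ ⟨by linarith, by linarith⟩ (by linarith)
        have h5 := hcon x
        rw [hEdef] at h5
        have h6 : 2 ≤ v' x := by nlinarith
        nlinarith
      have h := hG ⟨le_refl b, hc.1⟩ ⟨hc.1, le_refl c⟩ hc.1
      simp only [hb3, hc8] at h
      linarith [hcon c, hE0 b]
    -- conclusion through cluster points
    apply (isCompact_Icc (a := (0:ℝ)) (b := M)).tendsto_nhds_of_unique_mapClusterPt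
      (Eventually.of_forall hmem)
    intro L hLm hLc
    have hDL : D L = 0 := by
      have h1 : MapClusterPt (D L) atTop (fun s => D (v s)) :=
        hLc.continuousAt_comp hDc.continuousAt
      exact (eq_of_nhds_neBot (h1.clusterPt.mono hDv)).symm ▸ rfl
    have hFL : F L ≤ E s₂ := by
      have h1 : MapClusterPt (F L) atTop (fun s => F (v s)) :=
        hLc.continuousAt_comp hFc.continuousAt
      by_contra h
      push Not at h
      have h2 := h1.frequently (lt_mem_nhds h)
      obtain ⟨s, hs, hs'⟩ := (h2.and_eventually (eventually_ge_atTop s₂)).exists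
      linarith [hFE s, hEanti hs']
    have := (hH1 L).1 hDL
    simp only [mem_insert_iff, mem_singleton_iff] at this
    rcases this with h | h | h | h
    · linarith [hlow L ⟨by linarith, by linarith⟩]
    · linarith [hlow L ⟨by linarith, by linarith⟩]
    · linarith [hlow L ⟨by linarith, by linarith⟩]
    · exact h

/-- Appendix example: for a potential satisfying (H1)-(H5), the heteroclinic of the gradient
flow emanating from `0` ends at `1`, while the heteroclinic of the damped second-order
equation emanating from `0` ends at `9`. -/
theorem appendix_example
    (F : ℝ → ℝ) (hF : ContDiff ℝ 2 F)
    (hF0 : F 0 = 0) (hFneg : ∀ x < (0 : ℝ), 0 < F x)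
    (hFcoer : Filter.Tendsto F Filter.atTop Filter.atTop)
    -- (H1)
    (hH1 : ∀ x : ℝ, deriv F x = 0 ↔ x ∈ ({0, 1, 2, 9} : Set ℝ))
    -- (H2)
    (hH2 : F 1 = -1)
    -- (H3)
    (η : ℝ) (hη : 0 < η) (hη' : η ≤ 1 / 10) (hH3 : F 2 = -1 + η)
    -- (H4)
    (hH4 : F 3 = -3) (hH4' : ∀ x ∈ Set.Icc (3 : ℝ) 8, deriv F x ≤ -1)
    -- (H5)
    (hH5₁ : 0 < deriv (deriv F) 1) (hH5₉ : 0 < deriv (deriv F) 9)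
    -- v₁ : nonconstant C¹ solution of (1/4) v̇ = −F'(v) with v₁ → 0 at −∞
    (v₁ v₁' : ℝ → ℝ)
    (hv₁ : ∀ s : ℝ, HasDerivAt v₁ (v₁' s) s)
    (hv₁c : Continuous v₁')
    (hv₁eq : ∀ s : ℝ, (1 / 4) * v₁' s = -deriv F (v₁ s))
    (hv₁nc : ∃ s₁ s₂ : ℝ, v₁ s₁ ≠ v₁ s₂)
    (hv₁lim : Filter.Tendsto v₁ Filter.atBot (𝓝 0))
    -- v₂ : nonconstant C² solution of v̈ + (1/4) v̇ = −F'(v) with v₂ → 0, v̇₂ → 0 at −∞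
    (v₂ v₂' v₂'' : ℝ → ℝ)
    (hv₂ : ∀ s : ℝ, HasDerivAt v₂ (v₂' s) s)
    (hv₂' : ∀ s : ℝ, HasDerivAt v₂' (v₂'' s) s)
    (hv₂c : Continuous v₂'')
    (hv₂eq : ∀ s : ℝ, v₂'' s + (1 / 4) * v₂' s = -deriv F (v₂ s))
    (hv₂nc : ∃ s₁ s₂ : ℝ, v₂ s₁ ≠ v₂ s₂)
    (hv₂lim : Filter.Tendsto v₂ Filter.atBot (𝓝 0))
    (hv₂lim' : Filter.Tendsto v₂' Filter.atBot (𝓝 0)) :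
    Filter.Tendsto v₁ Filter.atTop (𝓝 1) ∧ Filter.Tendsto v₂ Filter.atTop (𝓝 9) := by
  have hF' : ContDiff ℝ 1 (deriv F) := by
    have h2 : ContDiff ℝ (1 + 1) F := by
      have e : (1 + 1 : WithTop ℕ∞) = 2 := by norm_num
      rw [e]; exact hF
    exact (contDiff_succ_iff_deriv.1 h2).2.2
  have hFD : ∀ x, HasDerivAt F (deriv F x) x := fun x =>
    (hF.differentiable (by norm_num) x).hasDerivAt
  have hDD : ∀ x, HasDerivAt (deriv F) (deriv (deriv F) x) x := fun x =>
    (hF'.differentiable (by norm_num) x).hasDerivAt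
  have hD2 : Continuous (deriv (deriv F)) := hF'.continuous_deriv le_rfl
  have hDc : Continuous (deriv F) := hF'.continuous
  have hFc : Continuous F := hF.continuous
  have hne : ∀ x, x ≠ 0 → x ≠ 1 → x ≠ 2 → x ≠ 9 → deriv F x ≠ 0 := by
    intro x h0 h1 h2 h9 h
    have := (hH1 x).1 h
    simp only [mem_insert_iff, mem_singleton_iff] at this
    tauto
  have neg01 : ∀ x ∈ Ioo (0:ℝ) 1, deriv F x < 0 := by
    obtain ⟨c, hc, hce⟩ := exists_hasDerivAt_eq_slope F (deriv F) (show (0:ℝ) < 1 by norm_num)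
      hFc.continuousOn (fun x _ => hFD x)
    intro x hx
    refine aux_sign _ hDc 0 1 c x (fun y hy => ?_) hc (by rw [hce, hH2, hF0]; norm_num) hx
    obtain ⟨h1, h2⟩ := hy
    apply hne <;> intro h <;> linarith
  have neg29 : ∀ x ∈ Ioo (2:ℝ) 9, deriv F x < 0 := by
    intro x hx
    refine aux_sign _ hDc 2 9 3 x (fun y hy => ?_) ⟨by norm_num, by norm_num⟩
      (by linarith [hH4' 3 ⟨by norm_num, by norm_num⟩]) hx
    obtain ⟨h1, h2⟩ := hy
    apply hne <;> intro h <;> linarith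
  have pos12 : ∀ x ∈ Ioo (1:ℝ) 2, deriv F x > 0 := by
    obtain ⟨c, hc, hce⟩ := exists_hasDerivAt_eq_slope F (deriv F) (show (1:ℝ) < 2 by norm_num)
      hFc.continuousOn (fun x _ => hFD x)
    intro x hx
    have := aux_sign (fun y => - deriv F y) hDc.neg 1 2 c x (fun y hy => ?_) hc
      (by simp only [hce, hH2, hH3]; norm_num; exact hη) hx
    · simpa using this
    · obtain ⟨h1, h2⟩ := hy
      rw [neg_ne_zero]
      apply hne <;> intro h <;> linarith
  have anti01 : AntitoneOn F (Icc 0 1) := by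
    apply antitoneOn_of_hasDerivWithinAt_nonpos (convex_Icc 0 1) hFc.continuousOn
      (fun x _ => (hFD x).hasDerivWithinAt)
    intro y hy
    rw [interior_Icc] at hy
    exact (neg01 y hy).le
  have mono12 : MonotoneOn F (Icc 1 2) := by
    apply monotoneOn_of_hasDerivWithinAt_nonneg (convex_Icc 1 2) hFc.continuousOn
      (fun x _ => (hFD x).hasDerivWithinAt)
    intro y hy
    rw [interior_Icc] at hy
    exact (pos12 y hy).le
  have hlow : ∀ x ∈ Icc (0:ℝ) 2, -1 ≤ F x := by
    intro x hx
    rw [← hH2]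
    rcases le_total x 1 with h | h
    · exact anti01 ⟨hx.1, h⟩ ⟨by norm_num, le_rfl⟩ h
    · exact mono12 ⟨le_rfl, by norm_num⟩ ⟨h, hx.2⟩ h
  have hup : ∀ x ∈ Icc (1:ℝ) 2, F x ≤ -(9/10) := by
    intro x hx
    have := mono12 hx ⟨by norm_num, le_rfl⟩ hx.2
    linarith
  exact ⟨aux_part1 F (deriv F) _ hFD hDD hD2 hF0 hFneg ((hH1 0).2 (by simp)) ((hH1 1).2 (by simp))
      neg01 v₁ v₁' hv₁ hv₁eq hv₁nc hv₁lim,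
    aux_part2 F (deriv F) _ hFD hDD hD2 hF0 hFneg hFcoer hH1 neg01 neg29 hlow hup hH4
      v₂ v₂' v₂'' hv₂ hv₂' hv₂eq hv₂nc hv₂lim hv₂lim'⟩
end
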